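/- For all integers r ≥ 3, a ∈ {1,…,r−1} and b ∈ {1,…,r−2}, the unitary minimal Virasoro character admits the fermionic representation χ^{(r−1,r)}_{b,a}(q) = f_{a,b} Σ_{m ≡ Q_{a,b}} ( q^{(1/4) mᵀC m − (1/2) m_{r−a−1}} / (q)_{m_1} ) ∏_{j=2}^{r−3} [ (1/2)(I m + e_{r−a−1} + e_{r−b−1})_j ; m_j ], as an identity of formal power series in q (all exponents occurring are integers). -/

import Mathlib

attribute [local instance] Classical.propDecidable

noncomputable section

variable {K : Type*} [Field K]

/-- `(q)_n` where `q = t^4` (the variable `t` stands for `q^{1/4}`). -/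
def qp (t : K) (n : ℕ) : K :=
  ∏ k ∈ Finset.range n, (1 - t ^ (4 * (k + 1)))

/-- Gaussian polynomial `[N; m]` in the variable `q = t^4`. -/
def gauss (t : K) (N m : ℤ) : K :=
  if 0 ≤ m ∧ m ≤ N then qp t N.toNat / (qp t m.toNat * qp t (N - m).toNat) else 0

/-- Gaussian polynomial `[N2/2; m]` (zero if `N2` is odd). -/
def gaussHalf (t : K) (N2 m : ℤ) : K :=
  if N2 % 2 = 0 then gauss t (N2 / 2) m else 0

/-- Incidence matrix of the Dynkin diagram `A_d` (indices `i : Fin d` stand for `i+1`). -/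
def inc (d : ℕ) (i k : Fin d) : ℤ := if (i : ℕ) + 1 = (k : ℕ) ∨ (k : ℕ) + 1 = (i : ℕ) then 1 else 0

/-- Cartan matrix of `A_d`. -/
def cartan (d : ℕ) (i k : Fin d) : ℤ := (if i = k then 2 else 0) - inc d i k

/-- the `s`-th unit vector, with the convention `e_0 = e_{d+1} = 0`. -/
def uv (d : ℕ) (s : ℤ) (i : Fin d) : ℤ := if ((i : ℕ) : ℤ) + 1 = s then 1 else 0

/-- `m_s`, with the conventions `m_0 = m_{d+1} = 0`. -/
def mAt (d : ℕ) (m : Fin d → ℕ) (s : ℤ) : ℤ := ∑ i, uv d s i * (m i : ℤ)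

/-- `mᵀ C m` for the `A_d` Cartan matrix. -/
def quadC (d : ℕ) (m : Fin d → ℕ) : ℤ := ∑ i, ∑ k, (m i : ℤ) * cartan d i k * (m k : ℤ)

/-- the vector `Q_{a,b}`. -/
def Qab (r a b : ℕ) (i : Fin (r - 3)) : ℕ :=
  min (a - 1) (r - ((i : ℕ) + 1) - 2) + min (b - 1) (r - ((i : ℕ) + 1) - 2)

/-- the parity restriction `m ≡ Q_{a,b} (mod 2)`. -/
def parity (r a b : ℕ) (m : Fin (r - 3) → ℕ) : Prop := ∀ i, m i % 2 = Qab r a b i % 2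

/-- `(I m + L e_1 + e_{r-a-1} + e_{r-b-1})_i`. -/
def topE (r a b L : ℕ) (m : Fin (r - 3) → ℕ) (i : Fin (r - 3)) : ℤ :=
  (∑ k, inc (r - 3) i k * (m k : ℤ)) + (L : ℤ) * uv (r - 3) 1 i
    + uv (r - 3) ((r : ℤ) - a - 1) i + uv (r - 3) ((r : ℤ) - b - 1) i

/-- the summand `q^{(1/4) mᵀCm - (1/2) m_{r-a-1}} ∏_j [(1/2)(Im + Le_1 + e_{r-a-1} + e_{r-b-1})_j; m_j]`,
in the variable `t = q^{1/4}`. -/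
def fermTerm (r a b L : ℕ) (t : K) (m : Fin (r - 3) → ℕ) : K :=
  t ^ (quadC (r - 3) m - 2 * mAt (r - 3) m ((r : ℤ) - a - 1))
    * ∏ i, gaussHalf t (topE r a b L m i) (m i)

/-- the fermionic sum `Σ_{m ≡ Q_{a,b}} (⋯)`. -/
def fermSum (r a b L : ℕ) (t : K) : K :=
  ∑ᶠ m : Fin (r - 3) → ℕ, if parity r a b m then fermTerm r a b L t m else 0

/-- `(I m + c e_1 + e_{r-a-1} + e_{r-b-1})_i`. -/
def topC (r a b : ℕ) (c : ℤ) (m : Fin (r - 3) → ℕ) (i : Fin (r - 3)) : ℤ :=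
  (∑ k, inc (r - 3) i k * (m k : ℤ)) + c * uv (r - 3) 1 i
    + uv (r - 3) ((r : ℤ) - a - 1) i + uv (r - 3) ((r : ℤ) - b - 1) i

/-- `m_s` as a natural number (zero if `s` is out of range). -/
def mAtN (d : ℕ) (m : Fin d → ℕ) (s : ℕ) : ℕ :=
  ∑ i : Fin d, if (i : ℕ) + 1 = s then m i else 0

/-- the bilinear form `vᵀ B w` with `B_{j,ℓ} = min(j,ℓ)` (tadpole inverse Cartan matrix). -/
def tadB (k : ℕ) (v w : Fin k → ℤ) : ℤ :=
  ∑ i : Fin k, ∑ l : Fin k, v i * (min ((i : ℕ) + 1) ((l : ℕ) + 1) : ℤ) * w l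

/-- the variable `t = q^{1/4}` in the field of formal Laurent series `ℚ⸨X⸩`. -/
def tL : LaurentSeries ℚ := HahnSeries.single 1 1

/-- the Euler product `(q)_∞ = ∏_{k ≥ 1} (1 - q^k)` with `q = t^4`. -/
def eulerInf : LaurentSeries ℚ := ∏' k : ℕ, (1 - tL ^ (4 * (k + 1)))

/-- the normalized Virasoro character `χ^{(p,p')}_{R,S}(q)`, written in the variable
`t = q^{1/4}` (all exponents multiplied by `4`). -/
def virChar (p p' R S : ℕ) : LaurentSeries ℚ :=
  eulerInf⁻¹ * ∑' j : ℤ,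
    (tL ^ (4 * (j * ((p : ℤ) * p' * j + (p' : ℤ) * R - (p : ℤ) * S)))
      - tL ^ (4 * ((j * p + R) * (j * p' + S))))
section GaussAlgebra

variable {t : K}

theorem qp_succ (t : K) (n : ℕ) : qp t (n + 1) = qp t n * (1 - t ^ (4 * (n + 1))) := by
  unfold qp
  rw [Finset.prod_range_succ]

theorem qp_zero (t : K) : qp t 0 = 1 := by
  simp [qp]

theorem gauss_add (t : K) (k l : ℕ) :
    gauss t ((k : ℤ) + l) k = qp t (k + l) / (qp t k * qp t l) := by
  unfold gauss
  rw [if_pos (by omega)]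
  congr 2
  congr 1
  omega

theorem gauss_eq_zero {N m : ℤ} (h : m < 0 ∨ N < m) : gauss t N m = 0 := by
  unfold gauss
  rw [if_neg (by omega)]

theorem gauss_ne_zero {N m : ℤ} (h : gauss t N m ≠ 0) : 0 ≤ m ∧ m ≤ N := by
  by_contra hc
  exact h (gauss_eq_zero (by omega))

theorem gauss_zero_right (hq : ∀ n, qp t n ≠ 0) {N : ℤ} (h : 0 ≤ N) : gauss t N 0 = 1 := by
  lift N to ℕ using h
  have := gauss_add t 0 N
  simp only [Nat.cast_zero, zero_add, qp_zero, one_mul] at this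
  rw [this, div_self (hq _)]

theorem gauss_self (hq : ∀ n, qp t n ≠ 0) {N : ℤ} (h : 0 ≤ N) : gauss t N N = 1 := by
  lift N to ℕ using h
  have := gauss_add t N 0
  simp only [Nat.cast_zero, add_zero, qp_zero, mul_one] at this
  rw [this, div_self (hq _)]

theorem gauss_symm (t : K) (N m : ℤ) : gauss t N m = gauss t N (N - m) := by
  by_cases h : 0 ≤ m ∧ m ≤ N
  · obtain ⟨k, rfl⟩ := Int.eq_ofNat_of_zero_le h.1
    obtain ⟨l, hl⟩ := Int.eq_ofNat_of_zero_le (sub_nonneg.2 h.2)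
    obtain rfl : N = (k : ℤ) + l := by omega
    rw [gauss_add, show (k : ℤ) + l - k = l by ring, add_comm (k : ℤ) l, gauss_add,
      add_comm l k, mul_comm]
  · rw [gauss_eq_zero (by omega), gauss_eq_zero (by omega)]

theorem pascal1 (hq : ∀ n, qp t n ≠ 0) (N m : ℤ) (h : ¬ (N = 0 ∧ m = 0)) :
    gauss t N m = gauss t (N - 1) (m - 1) + t ^ (4 * m) * gauss t (N - 1) m := by
  by_cases h0 : m < 0
  · rw [gauss_eq_zero (by omega), gauss_eq_zero (by omega), gauss_eq_zero (by omega)]; simp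
  by_cases h1 : N < m
  · rw [gauss_eq_zero (by omega), gauss_eq_zero (by omega), gauss_eq_zero (by omega)]; simp
  by_cases h2 : m = 0
  · subst h2
    rw [gauss_zero_right hq (by omega), gauss_eq_zero (by omega), gauss_zero_right hq (by omega)]
    simp
  by_cases h3 : m = N
  · subst h3
    rw [gauss_self hq (by omega), gauss_self hq (by omega), gauss_eq_zero (by omega)]
    simp
  obtain ⟨k, hk⟩ := Int.eq_ofNat_of_zero_le (show 0 ≤ m - 1 by omega)
  obtain ⟨l, hl⟩ := Int.eq_ofNat_of_zero_le (show 0 ≤ N - m - 1 by omega)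
  obtain rfl : m = ((k + 1 : ℕ) : ℤ) := by push_cast; omega
  obtain rfl : N = ((k + 1 : ℕ) : ℤ) + ((l + 1 : ℕ) : ℤ) := by push_cast at *; omega
  rw [gauss_add]
  have e1 : gauss t (((k + 1 : ℕ) : ℤ) + ((l + 1 : ℕ) : ℤ) - 1) (((k + 1 : ℕ) : ℤ) - 1)
      = qp t (k + (l + 1)) / (qp t k * qp t (l + 1)) := by
    rw [← gauss_add]; congr 1 <;> push_cast <;> ring
  have e2 : gauss t (((k + 1 : ℕ) : ℤ) + ((l + 1 : ℕ) : ℤ) - 1) ((k + 1 : ℕ) : ℤ)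
      = qp t (k + 1 + l) / (qp t (k + 1) * qp t l) := by
    rw [← gauss_add]; congr 1; push_cast; ring
  rw [e1, e2, show k + 1 + (l + 1) = (k + l + 1) + 1 by ring, show k + (l + 1) = k + l + 1 by ring,
    show k + 1 + l = k + l + 1 by ring, qp_succ t (k + l + 1)]
  have a1 : qp t (k + 1) = qp t k * (1 - t ^ (4 * (k + 1))) := qp_succ t k
  have a2 : qp t (l + 1) = qp t l * (1 - t ^ (4 * (l + 1))) := qp_succ t l
  have n1 := hq (k + 1)
  have n2 := hq (l + 1)
  rw [a1] at n1
  rw [a2] at n2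
  have n3 := hq k
  have n4 := hq l
  have n5 := right_ne_zero_of_mul n1
  have n6 := right_ne_zero_of_mul n2
  rw [a1, a2]
  have ez : t ^ (4 * ((k + 1 : ℕ) : ℤ)) = t ^ (4 * (k + 1)) := by
    rw [← zpow_natCast]; congr 1
  rw [ez]
  have ex : t ^ (4 * (k + l + 1 + 1)) = t ^ (4 * (k + 1)) * t ^ (4 * (l + 1)) := by
    rw [← pow_add]; congr 1; ring
  rw [ex]
  field_simp
  ring

theorem pascal2 (hq : ∀ n, qp t n ≠ 0) (N m : ℤ) (h : ¬ (N = 0 ∧ m = 0)) :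
    gauss t N m = gauss t (N - 1) m + t ^ (4 * (N - m)) * gauss t (N - 1) (m - 1) := by
  rw [gauss_symm, pascal1 hq N (N - m) (by omega), gauss_symm t (N - 1) m,
    gauss_symm t (N - 1) (m - 1), show N - 1 - m = N - m - 1 by ring,
    show N - 1 - (m - 1) = N - m by ring]

theorem trinom (hq : ∀ n, qp t n ≠ 0) (c n p : ℤ) :
    gauss t c n * gauss t n p = gauss t c p * gauss t (c - p) (n - p) := by
  by_cases h : 0 ≤ p ∧ p ≤ n ∧ n ≤ c
  · obtain ⟨P, rfl⟩ := Int.eq_ofNat_of_zero_le h.1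
    obtain ⟨l, hl⟩ := Int.eq_ofNat_of_zero_le (sub_nonneg.2 h.2.1)
    obtain ⟨j, hj⟩ := Int.eq_ofNat_of_zero_le (sub_nonneg.2 h.2.2)
    obtain rfl : n = (P : ℤ) + l := by omega
    obtain rfl : c = (P : ℤ) + l + j := by omega
    have e1 : gauss t ((P : ℤ) + l + j) ((P : ℤ) + l)
        = qp t (P + l + j) / (qp t (P + l) * qp t j) := by
      rw [← gauss_add]; push_cast; rfl
    have e2 : gauss t ((P : ℤ) + l + j) (P : ℤ)
        = qp t (P + (l + j)) / (qp t P * qp t (l + j)) := by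
      rw [← gauss_add]; congr 1; push_cast; ring
    have e3 : gauss t ((P : ℤ) + l + j - P) ((P : ℤ) + l - P)
        = qp t (l + j) / (qp t l * qp t j) := by
      rw [← gauss_add]; congr 1 <;> ring
    rw [e1, e2, e3, gauss_add, show P + (l + j) = P + l + j by ring]
    have := hq P
    have := hq l
    have := hq j
    have := hq (P + l)
    have := hq (l + j)
    field_simp
  · have a : gauss t c n * gauss t n p = 0 := by
      by_contra hc
      have h1 := gauss_ne_zero (left_ne_zero_of_mul hc)
      have h2 := gauss_ne_zero (right_ne_zero_of_mul hc)
      omega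
    have b : gauss t c p * gauss t (c - p) (n - p) = 0 := by
      by_contra hc
      have h1 := gauss_ne_zero (left_ne_zero_of_mul hc)
      have h2 := gauss_ne_zero (right_ne_zero_of_mul hc)
      omega
    rw [a, b]

theorem vand_base (hq : ∀ n, qp t n ≠ 0) (s : ℤ) (S : Finset ℤ) (hs : s ∈ S) (F : ℤ → K) :
    ∑ k ∈ S, F k * gauss t ((0 : ℕ) : ℤ) (k - s) = F s := by
  rw [Finset.sum_eq_single s]
  · rw [sub_self, gauss_zero_right hq (by simp), mul_one]
  · intro b _ hb
    rw [gauss_eq_zero (by push_cast; omega), mul_zero]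
  · intro h; exact absurd hs h

theorem vand1 (ht : t ≠ 0) (hq : ∀ n, qp t n ≠ 0) (m n : ℕ) (A s : ℤ) (S : Finset ℤ)
    (hS : Finset.Icc s (s + m) ⊆ S) :
    ∑ k ∈ S, t ^ (4 * ((m + s - k) * (A - k))) * gauss t n (A - k) * gauss t m (k - s)
      = gauss t (m + n) (A - s) := by
  induction m generalizing s with
  | zero =>
    rw [vand_base hq s S (hS (by simp))]
    simp
  | succ m ih =>
    have e : ∀ k ∈ S, t ^ (4 * ((((m + 1 : ℕ) : ℤ) + s - k) * (A - k))) * gauss t n (A - k)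
          * gauss t ((m + 1 : ℕ) : ℤ) (k - s)
        = t ^ (4 * ((m + (s + 1) - k) * (A - k))) * gauss t n (A - k) * gauss t m (k - (s + 1))
          + t ^ (4 * (A - s)) * (t ^ (4 * ((m + s - k) * (A - k))) * gauss t n (A - k)
            * gauss t m (k - s)) := by
      intro k _
      rw [pascal1 hq _ (k - s) (by push_cast; omega)]
      have e1 : t ^ (4 * (A - s)) * t ^ (4 * ((m + s - k) * (A - k)))
          = t ^ (4 * ((((m + 1 : ℕ) : ℤ) + s - k) * (A - k))) * t ^ (4 * (k - s)) := by
        rw [← zpow_add₀ ht, ← zpow_add₀ ht]; congr 1; push_cast; ring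
      have e2 : ((m + (s + 1) - k) * (A - k)) = ((((m + 1 : ℕ) : ℤ) + s - k) * (A - k)) := by
        push_cast; ring
      rw [e2, show ((m + 1 : ℕ) : ℤ) - 1 = m by push_cast; ring,
        show k - (s + 1) = k - s - 1 by ring, mul_add]
      linear_combination (-gauss t n (A - k) * gauss t m (k - s)) * e1
    rw [Finset.sum_congr rfl e, Finset.sum_add_distrib, ← Finset.mul_sum,
      ih (s + 1) (fun x hx => hS (by simp only [Finset.mem_Icc] at *; push_cast; omega)),
      ih s (fun x hx => hS (by simp only [Finset.mem_Icc] at *; push_cast; omega)),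
      pascal1 hq (((m + 1 : ℕ) : ℤ) + n) (A - s) (by push_cast; omega)]
    congr 2
    · push_cast; ring
    · ring
    · congr 1; push_cast; ring

theorem vand2 (ht : t ≠ 0) (hq : ∀ n, qp t n ≠ 0) (m n : ℕ) (A s : ℤ) (S : Finset ℤ)
    (hS : Finset.Icc s (s + m) ⊆ S) :
    ∑ k ∈ S, t ^ (4 * ((k - s) * (n - (A - k)))) * gauss t n (A - k) * gauss t m (k - s)
      = gauss t (m + n) (A - s) := by
  induction m generalizing s with
  | zero =>
    rw [vand_base hq s S (hS (by simp))]
    simp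
  | succ m ih =>
    have e : ∀ k ∈ S, t ^ (4 * ((k - s) * (n - (A - k)))) * gauss t n (A - k)
          * gauss t ((m + 1 : ℕ) : ℤ) (k - s)
        = t ^ (4 * ((k - s) * (n - (A - k)))) * gauss t n (A - k) * gauss t m (k - s)
          + t ^ (4 * ((m + 1 + n) - (A - s))) * (t ^ (4 * ((k - (s + 1)) * (n - (A - k))))
            * gauss t n (A - k) * gauss t m (k - (s + 1))) := by
      intro k _
      rw [pascal2 hq _ (k - s) (by push_cast; omega)]
      have e1 : t ^ (4 * (((m : ℤ) + 1 + n) - (A - s))) * t ^ (4 * ((k - (s + 1)) * (n - (A - k))))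
          = t ^ (4 * ((k - s) * (n - (A - k)))) * t ^ (4 * (((m + 1 : ℕ) : ℤ) - (k - s))) := by
        rw [← zpow_add₀ ht, ← zpow_add₀ ht]; congr 1; push_cast; ring
      rw [show ((m + 1 : ℕ) : ℤ) - 1 = m by push_cast; ring,
        show k - (s + 1) = k - s - 1 by ring, mul_add]
      rw [show k - (s + 1) = k - s - 1 by ring] at e1
      linear_combination (-gauss t n (A - k) * gauss t m (k - s - 1)) * e1
    rw [Finset.sum_congr rfl e, Finset.sum_add_distrib, ← Finset.mul_sum,
      ih (s + 1) (fun x hx => hS (by simp only [Finset.mem_Icc] at *; push_cast; omega)),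
      ih s (fun x hx => hS (by simp only [Finset.mem_Icc] at *; push_cast; omega)),
      pascal2 hq (((m + 1 : ℕ) : ℤ) + n) (A - s) (by push_cast; omega)]
    rw [show ((m + 1 : ℕ) : ℤ) + n - 1 = m + n by push_cast; ring,
      show A - (s + 1) = A - s - 1 by ring, show ((m + 1 : ℕ) : ℤ) = m + 1 by push_cast; rfl]

theorem saal (ht : t ≠ 0) (hq : ∀ n, qp t n ≠ 0) (u v : ℕ) (s c : ℤ) :
    ∑ k ∈ Finset.Icc (0 : ℤ) u, t ^ (4 * ((u - k) * (v + s - k))) * gauss t u k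
        * gauss t v (k - s) * gauss t (c + k) (u + v)
      = gauss t (c + s) (v + s) * gauss t c (u - s) := by
  by_cases hc : c < 0
  · rw [gauss_eq_zero (N := c) (by omega), mul_zero]
    apply Finset.sum_eq_zero
    intro k hk
    rw [Finset.mem_Icc] at hk
    rw [gauss_eq_zero (N := c + k) (by omega), mul_zero]
  lift c to ℕ using not_lt.1 hc
  set S := Finset.Icc (0 : ℤ) u with hS
  have h1 : ∀ k ∈ S, t ^ (4 * (((u : ℤ) - k) * (v + s - k))) * gauss t u k
        * gauss t v (k - s) * gauss t (c + k) (u + v)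
      = ∑ i ∈ S, (t ^ (4 * (((u : ℤ) - i) * (v + s - i))) * gauss t u i
          * gauss t c (u + v - i)) *
        (t ^ (4 * ((k - i) * (v - (v + s - k)))) * gauss t v (v + s - k)
          * gauss t (u - i) (k - i)) := by
    intro k hk
    rw [hS, Finset.mem_Icc] at hk
    obtain ⟨kn, rfl⟩ := Int.eq_ofNat_of_zero_le hk.1
    have := vand1 ht hq kn c (u + v) 0 S (by
      intro x hx; simp only [hS, Finset.mem_Icc] at *; omega)
    rw [show (c : ℤ) + kn = kn + c by ring, show ((u : ℤ) + v) = u + v - 0 by ring, ← this,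
      Finset.mul_sum]
    apply Finset.sum_congr rfl
    intro i _
    have e1 : t ^ (4 * (((u : ℤ) - i) * (v + s - i))) * t ^ (4 * ((kn - i) * (v - (v + s - kn))))
        = t ^ (4 * (((u : ℤ) - kn) * (v + s - kn))) * t ^ (4 * ((kn + 0 - i) * (u + v - i))) := by
      rw [← zpow_add₀ ht, ← zpow_add₀ ht]; congr 1; ring
    have e2 := trinom hq u kn i
    have e3 : gauss t v (v + s - kn) = gauss t v (kn - s) := by
      rw [gauss_symm]; congr 1; ring
    rw [e3, sub_zero, sub_zero]
    calc _ = (t ^ (4 * (((u : ℤ) - kn) * (v + s - kn))) * t ^ (4 * ((kn + 0 - i) * (u + v - i))))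
          * (gauss t u kn * gauss t kn i) * gauss t v (kn - s) * gauss t c (u + v - i) := by
            ring
      _ = _ := by rw [← e1, e2]; ring
  rw [Finset.sum_congr rfl h1, Finset.sum_comm]
  have h2 : ∀ i ∈ S, ∑ k ∈ S, (t ^ (4 * (((u : ℤ) - i) * (v + s - i))) * gauss t u i
          * gauss t c (u + v - i)) *
        (t ^ (4 * ((k - i) * (v - (v + s - k)))) * gauss t v (v + s - k)
          * gauss t (u - i) (k - i))
      = gauss t c (u - s) * (t ^ (4 * (((u : ℤ) + 0 - i) * (v + s - i)))
          * gauss t (c - (u - s)) (v + s - i) * gauss t u (i - 0)) := by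
    intro i hi
    rw [← Finset.mul_sum]
    rw [hS, Finset.mem_Icc] at hi
    obtain ⟨w, hw⟩ := Int.eq_ofNat_of_zero_le (sub_nonneg.2 hi.2)
    have := vand2 ht hq w v (v + s) i S (by
      intro x hx; simp only [hS, Finset.mem_Icc] at *; omega)
    rw [hw, this, ← hw]
    have e2 := trinom hq c (u + v - i) (u - s)
    rw [gauss_symm t (u + v - i) (u - s), show (u : ℤ) + v - i - (u - s) = v + s - i by ring] at e2
    rw [show (u : ℤ) - i + v = u + v - i by ring, sub_zero, add_zero]
    linear_combination (t ^ (4 * (((u : ℤ) - i) * (v + s - i))) * gauss t u i) * e2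
  rw [Finset.sum_congr rfl h2, ← Finset.mul_sum]
  by_cases hcu : (c : ℤ) < u - s
  · rw [gauss_eq_zero (Or.inr hcu)]; ring
  obtain ⟨n, hn⟩ := Int.eq_ofNat_of_zero_le (sub_nonneg.2 (not_lt.1 hcu))
  rw [hn, vand1 ht hq u n (v + s) 0 S (by
    intro x hx; simp only [hS, Finset.mem_Icc] at *; omega), ← hn, mul_comm]
  congr 2 <;> ring

end GaussAlgebra

section Burge

variable {t : K}

/-- Gaussian polynomial with doubled arguments. -/
def gg (t : K) (N m : ℤ) : K :=
  if N % 2 = 0 ∧ m % 2 = 0 then gauss t (N / 2) (m / 2) else 0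

/-- The product of two Gaussian polynomials entering the Burge transform. -/
def BB (t : K) (x y α β : ℤ) : K := gg t (x + α - β) (y + α) * gg t (x - α + β) (y - α)

theorem gg_two (t : K) (u k : ℤ) : gg t (2 * u) (2 * k) = gauss t u k := by
  unfold gg
  rw [if_pos (by omega)]
  congr 1 <;> omega

theorem BB_of {x y α β u k : ℤ} (hu : x + α - β = 2 * u) (hk : y + α = 2 * k) :
    BB t x y α β = gauss t u k * gauss t (x - u) (y - k) := by
  unfold BB
  rw [hu, hk, gg_two, show x - α + β = 2 * (x - u) by linarith,
    show y - α = 2 * (y - k) by linarith, gg_two]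

theorem gg_zero_of_odd {N m : ℤ} (h : N % 2 ≠ 0 ∨ m % 2 ≠ 0) : gg t N m = 0 := by
  unfold gg
  rw [if_neg (by tauto)]

theorem BB_zero_of_odd {x y α β : ℤ} (h : (x + α - β) % 2 ≠ 0 ∨ (y + α) % 2 ≠ 0) :
    BB t x y α β = 0 := by
  unfold BB
  rw [gg_zero_of_odd h, zero_mul]

theorem BB_ne_zero {x y α β : ℤ} (h : BB t x y α β ≠ 0) :
    (x + α - β) % 2 = 0 ∧ (y + α) % 2 = 0 ∧ 0 ≤ y + α ∧ y + α ≤ x + α - β ∧ 0 ≤ y - α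
      ∧ y - α ≤ x - α + β := by
  by_cases h1 : (x + α - β) % 2 = 0
  · by_cases h2 : (y + α) % 2 = 0
    · obtain ⟨u, hu⟩ : ∃ u, x + α - β = 2 * u := ⟨(x + α - β) / 2, by omega⟩
      obtain ⟨k, hk⟩ : ∃ k, y + α = 2 * k := ⟨(y + α) / 2, by omega⟩
      rw [BB_of hu hk] at h
      have h3 := gauss_ne_zero (left_ne_zero_of_mul h)
      have h4 := gauss_ne_zero (right_ne_zero_of_mul h)
      refine ⟨h1, h2, ?_⟩
      omega
    · exact absurd (BB_zero_of_odd (Or.inr h2)) h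
  · exact absurd (BB_zero_of_odd (Or.inl h1)) h

theorem BB_neg (t : K) (x y α β : ℤ) : BB t x y (-α) (-β) = BB t x y α β := by
  unfold BB
  rw [mul_comm]
  congr 2 <;> ring

theorem sum_range_to_Icc (x α β : ℤ) (u : ℕ) (hu : x + α - β = 2 * u) (hv : (u : ℤ) ≤ x)
    (B : ℕ) (hB : x < B) (F : ℤ → K) :
    ∑ y ∈ Finset.range B, F y * BB t x y α β
      = ∑ k ∈ Finset.Icc (0 : ℤ) u, F (2 * k - α) * (gauss t u k * gauss t (x - u) (k - α)) := by
  apply Finset.sum_bij_ne_zero (fun (y : ℕ) _ _ => ((y : ℤ) + α) / 2)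
  · intro y _ h
    have := BB_ne_zero (right_ne_zero_of_mul h)
    rw [Finset.mem_Icc]
    omega
  · intro y _ h y' _ h' e
    have := BB_ne_zero (right_ne_zero_of_mul h)
    have := BB_ne_zero (right_ne_zero_of_mul h')
    omega
  · intro k hk h
    have h2 := right_ne_zero_of_mul h
    have h3 := gauss_ne_zero (left_ne_zero_of_mul h2)
    have h4 := gauss_ne_zero (right_ne_zero_of_mul h2)
    refine ⟨(2 * k - α).toNat, ?_, ?_, ?_⟩
    · rw [Finset.mem_range]; omega
    · have e : ((2 * k - α).toNat : ℤ) = 2 * k - α := by omega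
      rw [e, BB_of hu (k := k) (by ring), show 2 * k - α - k = k - α by ring]
      exact h
    · omega
  · intro y _ h
    have := BB_ne_zero (right_ne_zero_of_mul h)
    obtain ⟨k, hk⟩ : ∃ k, (y : ℤ) + α = 2 * k := ⟨(y + α) / 2, by omega⟩
    rw [BB_of hu hk, hk, show 2 * k / 2 = k by omega, show 2 * k - α = y by linarith,
      show (y : ℤ) - k = k - α by linarith]

theorem burge (ht : t ≠ 0) (hq : ∀ n, qp t n ≠ 0) (w x α β : ℤ) (hx : 0 ≤ x)
    (hαβ : (0 ≤ α ∧ 0 ≤ β) ∨ (α ≤ 0 ∧ β ≤ 0)) (B : ℕ) (hB : x < B) :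
    ∑ y ∈ Finset.range B, (t ^ ((x - y) ^ 2) * gaussHalf t (w + y) x) * BB t x y α β
      = t ^ (β ^ 2) * BB t w x (α + β) β := by
  by_cases hpar : (x + α - β) % 2 = 0
  swap
  · rw [Finset.sum_eq_zero (fun y _ => by rw [BB_zero_of_odd (Or.inl hpar), mul_zero]),
      BB_zero_of_odd (Or.inr (by omega)), mul_zero]
  obtain ⟨u, hu⟩ : ∃ u, x + α - β = 2 * u := ⟨(x + α - β) / 2, by omega⟩
  by_cases hwp : (w + α) % 2 = 0
  swap
  · rw [BB_zero_of_odd (Or.inl (by omega)), mul_zero]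
    apply Finset.sum_eq_zero
    intro y _
    by_contra h
    have h1 := BB_ne_zero (right_ne_zero_of_mul h)
    have h2 := right_ne_zero_of_mul (left_ne_zero_of_mul h)
    unfold gaussHalf at h2
    rw [if_neg (by omega)] at h2
    exact h2 rfl
  by_cases huv : 0 ≤ u ∧ u ≤ x
  swap
  · rw [Finset.sum_eq_zero]
    · by_contra h
      have h1 := BB_ne_zero (right_ne_zero_of_mul (Ne.symm h))
      omega
    · intro y _
      by_contra h
      have h1 := BB_ne_zero (right_ne_zero_of_mul h)
      omega
  obtain ⟨c, hc⟩ : ∃ c, w - α = 2 * c := ⟨(w - α) / 2, by omega⟩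
  obtain ⟨un, rfl⟩ := Int.eq_ofNat_of_zero_le huv.1
  obtain ⟨v, hv⟩ := Int.eq_ofNat_of_zero_le (sub_nonneg.2 huv.2)
  rw [sum_range_to_Icc (t := t) x α β un hu huv.2 B hB
    (fun y => t ^ ((x - y) ^ 2) * gaussHalf t (w + y) x), hv]
  have := saal ht hq un v α c
  rw [BB_of (u := c + α) (k := v + α) (by linarith) (by linarith),
    show w - (c + α) = c by linarith, show x - (v + α) = un - α by linarith, ← this,
    Finset.mul_sum]
  apply Finset.sum_congr rfl
  intro k _
  have e1 : gaussHalf t (w + (2 * k - α)) x = gauss t (c + k) (un + v) := by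
    unfold gaussHalf
    rw [if_pos (by omega)]
    congr 1 <;> omega
  have e2 : t ^ ((x - (2 * k - α)) ^ 2)
      = t ^ (β ^ 2) * t ^ (4 * ((un - k) * (v + α - k))) := by
    rw [← zpow_add₀ ht]
    congr 1
    obtain rfl : x = un + v := by linarith
    obtain rfl : β = v - un + α := by linarith
    ring
  rw [e1, e2]
  ring

theorem final_vand (ht : t ≠ 0) (hq : ∀ n, qp t n ≠ 0) (x α β : ℤ) (hx : 0 ≤ x)
    (hαβ : (0 ≤ α ∧ 0 ≤ β) ∨ (α ≤ 0 ∧ β ≤ 0)) (B : ℕ) (hB : x < B) :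
    ∑ y ∈ Finset.range B, t ^ ((y : ℤ) ^ 2) * BB t x y α β
      = t ^ (α ^ 2) * gg t (2 * x) (x + α + β) := by
  by_cases hpar : (x + α - β) % 2 = 0
  swap
  · rw [Finset.sum_eq_zero (fun y _ => by rw [BB_zero_of_odd (Or.inl hpar), mul_zero]),
      gg_zero_of_odd (Or.inr (by omega)), mul_zero]
  obtain ⟨u, hu⟩ : ∃ u, x + α - β = 2 * u := ⟨(x + α - β) / 2, by omega⟩
  by_cases huv : 0 ≤ u ∧ u ≤ x
  swap
  · rw [Finset.sum_eq_zero]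
    · rw [show x + α + β = 2 * (x - u + α) by linarith, gg_two]
      by_contra h
      have h1 := gauss_ne_zero (right_ne_zero_of_mul (Ne.symm h))
      omega
    · intro y _
      by_contra h
      have h1 := BB_ne_zero (right_ne_zero_of_mul h)
      omega
  obtain ⟨un, rfl⟩ := Int.eq_ofNat_of_zero_le huv.1
  obtain ⟨v, hv⟩ := Int.eq_ofNat_of_zero_le (sub_nonneg.2 huv.2)
  rw [sum_range_to_Icc (t := t) x α β un hu huv.2 B hB (fun y => t ^ (y ^ 2)), hv,
    show x + α + β = 2 * (v + α) by linarith, gg_two]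
  have := vand2 ht hq un v (v + α) 0 (Finset.Icc (0 : ℤ) un) (by simp)
  rw [show x = un + v by linarith, show (v : ℤ) + α = v + α - 0 by ring, ← this, Finset.mul_sum]
  apply Finset.sum_congr rfl
  intro k _
  have e2 : t ^ ((2 * k - α) ^ 2)
      = t ^ (α ^ 2) * t ^ (4 * ((k - 0) * (v - (v + α - k)))) := by
    rw [← zpow_add₀ ht]
    congr 1
    ring
  have e3 : gauss t v (k - α) = gauss t v (v + α - k) := by
    rw [gauss_symm]; congr 1; ring
  rw [e2, e3, sub_zero]
  ring

theorem pairA (ht : t ≠ 0) (hq : ∀ n, qp t n ≠ 0) (x y α β : ℤ)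
    (h1 : ¬ (x + 1 - α + β = 0 ∧ y = α ∧ 0 ≤ y ∧ y ≤ x + 1))
    (h2 : ¬ (x + α - β + 3 = 0 ∧ y + α + 2 = 0 ∧ 0 ≤ y ∧ y ≤ x + 1)) :
    BB t (x + 1) y α β - BB t (x + 1) y (α + 2) β
      = t ^ (2 * (y - α)) * BB t x y α (β - 1)
        - t ^ (2 * (y + α) + 4) * BB t x y (α + 2) (β + 1) := by
  by_cases hpar : (x + 1 + α - β) % 2 = 0 ∧ (y + α) % 2 = 0
  swap
  · rw [BB_zero_of_odd (by omega), BB_zero_of_odd (by omega), BB_zero_of_odd (by omega),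
      BB_zero_of_odd (by omega)]
    simp
  obtain ⟨u, hu⟩ : ∃ u, x + 1 + α - β = 2 * u := ⟨(x + 1 + α - β) / 2, by omega⟩
  obtain ⟨k, hk⟩ : ∃ k, y + α = 2 * k := ⟨(y + α) / 2, by omega⟩
  rw [BB_of hu hk, BB_of (u := u + 1) (k := k + 1) (by linarith) (by linarith),
    BB_of (u := u) (k := k) (by linarith) (by linarith),
    BB_of (u := u) (k := k + 1) (by linarith) (by linarith)]
  rw [show x + 1 - (u + 1) = x - u by ring, show 2 * (y - α) = 4 * (y - k) by linarith,
    show 2 * (y + α) + 4 = 4 * (k + 1) by linarith]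
  have e1 : gauss t u k * gauss t (x + 1 - u) (y - k)
      = gauss t u k * (gauss t (x - u) (y - (k + 1))
        + t ^ (4 * (y - k)) * gauss t (x - u) (y - k)) := by
    by_cases h : x + 1 - u = 0 ∧ y - k = 0
    · rw [gauss_eq_zero (N := u) (by omega)]; simp
    · rw [pascal1 hq _ _ h, show x + 1 - u - 1 = x - u by ring,
        show y - k - 1 = y - (k + 1) by ring]
  have e2 : gauss t (u + 1) (k + 1) * gauss t (x - u) (y - (k + 1))
      = (gauss t u k + t ^ (4 * (k + 1)) * gauss t u (k + 1))
        * gauss t (x - u) (y - (k + 1)) := by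
    by_cases h : u + 1 = 0 ∧ k + 1 = 0
    · rw [gauss_eq_zero (N := x - u) (by omega)]; simp
    · rw [pascal1 hq _ _ h, show u + 1 - 1 = u by ring, show k + 1 - 1 = k by ring]
  rw [e1, e2]
  ring

theorem pairB (ht : t ≠ 0) (hq : ∀ n, qp t n ≠ 0) (x y α β : ℤ)
    (h1 : ¬ (x + 1 - α + β = 0 ∧ y = α ∧ 0 ≤ y ∧ y ≤ x + 1))
    (h2 : ¬ (x + α - β + 3 = 0 ∧ y + α + 2 = 0 ∧ 0 ≤ y ∧ y ≤ x + 1)) :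
    BB t (x + 1) y α β - t ^ (4 * β) * BB t (x + 1) y (α + 2) β
      = BB t x y α (β - 1) - t ^ (4 * β) * BB t x y (α + 2) (β + 1) := by
  by_cases hpar : (x + 1 + α - β) % 2 = 0 ∧ (y + α) % 2 = 0
  swap
  · rw [BB_zero_of_odd (by omega), BB_zero_of_odd (by omega), BB_zero_of_odd (by omega),
      BB_zero_of_odd (by omega)]
  obtain ⟨u, hu⟩ : ∃ u, x + 1 + α - β = 2 * u := ⟨(x + 1 + α - β) / 2, by omega⟩
  obtain ⟨k, hk⟩ : ∃ k, y + α = 2 * k := ⟨(y + α) / 2, by omega⟩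
  rw [BB_of hu hk, BB_of (u := u + 1) (k := k + 1) (by linarith) (by linarith),
    BB_of (u := u) (k := k) (by linarith) (by linarith),
    BB_of (u := u) (k := k + 1) (by linarith) (by linarith)]
  rw [show x + 1 - (u + 1) = x - u by ring]
  have e1 : gauss t u k * gauss t (x + 1 - u) (y - k)
      = gauss t u k * (gauss t (x - u) (y - k)
        + t ^ (4 * (x + 1 - u - (y - k))) * gauss t (x - u) (y - (k + 1))) := by
    by_cases h : x + 1 - u = 0 ∧ y - k = 0
    · rw [gauss_eq_zero (N := u) (by omega)]; simp
    · rw [pascal2 hq _ _ h, show x + 1 - u - 1 = x - u by ring,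
        show y - k - 1 = y - (k + 1) by ring]
  have e2 : gauss t (u + 1) (k + 1) * gauss t (x - u) (y - (k + 1))
      = (gauss t u (k + 1) + t ^ (4 * (u - k)) * gauss t u k)
        * gauss t (x - u) (y - (k + 1)) := by
    by_cases h : u + 1 = 0 ∧ k + 1 = 0
    · rw [gauss_eq_zero (N := x - u) (by omega)]; simp
    · rw [pascal2 hq _ _ h, show u + 1 - 1 = u by ring, show k + 1 - 1 = k by ring,
        show u + 1 - (k + 1) = u - k by ring]
  have e3 : t ^ (4 * (x + 1 - u - (y - k))) = t ^ (4 * β) * t ^ (4 * (u - k)) := by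
    rw [← zpow_add₀ ht]; congr 1; linarith
  rw [e1, e2, e3]
  ring

end Burge

section Wsec

variable {t : K}

/-- The alternating sum of Burge kernels. -/
def WW (t : K) (ρ a b ε x y : ℤ) : K :=
  ∑ᶠ j : ℤ, t ^ (ρ * (2 * j + ε) ^ 2 + 2 * b * (2 * j + ε) + b - a)
    * (BB t x y (ρ * (2 * j + ε) + b - a) (2 * j + ε)
      - BB t x y (ρ * (2 * j + ε) + b + a) (2 * j + ε))

theorem fs_BB (x y δ : ℤ) (c : ℤ → K) (A : ℤ → ℤ) :
    Function.HasFiniteSupport (fun j => c j * BB t x y (A j) (2 * j + δ)) := by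
  refine (Set.finite_Icc (-(x + |δ|)) (x + |δ|)).subset ?_
  intro j hj
  have h := BB_ne_zero (right_ne_zero_of_mul hj)
  have h1 := le_abs_self δ
  have h2 := neg_abs_le δ
  rw [Set.mem_Icc]
  omega

theorem WW_split (t : K) (ρ a b ε x y : ℤ) : WW t ρ a b ε x y =
    (∑ᶠ j : ℤ, t ^ (ρ * (2 * j + ε) ^ 2 + 2 * b * (2 * j + ε) + b - a)
      * BB t x y (ρ * (2 * j + ε) + b - a) (2 * j + ε))
    - ∑ᶠ j : ℤ, t ^ (ρ * (2 * j + ε) ^ 2 + 2 * b * (2 * j + ε) + b - a)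
      * BB t x y (ρ * (2 * j + ε) + b + a) (2 * j + ε) := by
  unfold WW
  rw [← finsum_sub_distrib (fs_BB _ _ _ _ _) (fs_BB _ _ _ _ _)]
  simp only [mul_sub]

theorem fs_WW (ρ a b ε x y : ℤ) :
    Function.HasFiniteSupport (fun j : ℤ => t ^ (ρ * (2 * j + ε) ^ 2 + 2 * b * (2 * j + ε) + b - a)
    * (BB t x y (ρ * (2 * j + ε) + b - a) (2 * j + ε)
      - BB t x y (ρ * (2 * j + ε) + b + a) (2 * j + ε))) := by
  simp only [mul_sub]
  exact Set.Finite.subset (Set.Finite.union (fs_BB _ _ _ _ _) (fs_BB _ _ _ _ _)) (Function.support_sub _ _)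

theorem WW_shift (t : K) (ρ a b ε x y : ℤ) : WW t ρ a b (ε + 2) x y = WW t ρ a b ε x y := by
  unfold WW
  rw [← finsum_comp_equiv (Equiv.addRight (1 : ℤ))
    (f := fun j : ℤ => t ^ (ρ * (2 * j + ε) ^ 2 + 2 * b * (2 * j + ε) + b - a)
    * (BB t x y (ρ * (2 * j + ε) + b - a) (2 * j + ε)
      - BB t x y (ρ * (2 * j + ε) + b + a) (2 * j + ε)))]
  apply finsum_congr
  intro j
  have : 2 * (Equiv.addRight (1 : ℤ) j) + ε = 2 * j + (ε + 2) := by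
    simp; ring
  simp only [this]

/-- sign compatibility of the shifted charges. -/
theorem sign_aux (ρ a b β : ℤ) (hρ : 1 ≤ ρ)
    (h : (β % 2 = 0 ∧ -1 ≤ a ∧ -1 ≤ b ∧ a ≤ ρ - 1 ∧ b ≤ ρ - 1 ∧ (a = -1 ∧ b = -1 ∨ a ≠ -1 ∧ b ≠ -1))
      ∨ (β % 2 = 1 ∧ -1 ≤ a ∧ -1 ≤ b ∧ a ≤ ρ - 1 ∧ b ≤ ρ - 1 ∧ ((a = -1 ∧ 1 ≤ b) ∨ (b = -1 ∧ 1 ≤ a))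
        )) (c : ℤ)
    (hc : c = ρ * β + b - a ∨ c = ρ * β + b + a) :
    (0 ≤ c ∧ 0 ≤ β) ∨ (c ≤ 0 ∧ β ≤ 0) ∨ β = 0 := by
  rcases lt_trichotomy β 0 with hb | hb | hb
  · right; left
    refine ⟨?_, hb.le⟩
    rcases h with ⟨h, h1, h2, h3, h4, h5⟩ | ⟨h, h1, h2, h3, h4, h5⟩
    · have : β ≤ -2 := by omega
      have : ρ * β ≤ ρ * (-2) := by gcongr
      rcases hc with rfl | rfl <;> linarith
    · have : β ≤ -1 := by omega
      have : ρ * β ≤ ρ * (-1) := by gcongr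
      omega
  · right; right; exact hb
  · left
    refine ⟨?_, hb.le⟩
    rcases h with ⟨h, h1, h2, h3, h4, h5⟩ | ⟨h, h1, h2, h3, h4, h5⟩
    · have : 2 ≤ β := by omega
      have : ρ * 2 ≤ ρ * β := by gcongr
      omega
    · have : 1 ≤ β := by omega
      have : ρ * 1 ≤ ρ * β := by gcongr
      omega

theorem sign_aux' (ρ a b β : ℤ) (hρ : 1 ≤ ρ)
    (h : (β % 2 = 0 ∧ -1 ≤ a ∧ -1 ≤ b ∧ a ≤ ρ - 1 ∧ b ≤ ρ - 1 ∧ (a = -1 ∧ b = -1 ∨ a ≠ -1 ∧ b ≠ -1))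
      ∨ (β % 2 = 1 ∧ -1 ≤ a ∧ -1 ≤ b ∧ a ≤ ρ - 1 ∧ b ≤ ρ - 1 ∧ ((a = -1 ∧ 1 ≤ b) ∨ (b = -1 ∧ 1 ≤ a))
        )) (c : ℤ)
    (hc : c = ρ * β + b - a ∨ c = ρ * β + b + a) :
    (0 ≤ c ∧ 0 ≤ β) ∨ (c ≤ 0 ∧ β ≤ 0) := by
  rcases sign_aux ρ a b β hρ h c hc with h | h | h
  · exact Or.inl h
  · exact Or.inr h
  · omega

/-- state validity -/
def okst (ρ a b ε : ℤ) : Prop := 1 ≤ ρ ∧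
  ((ε % 2 = 0 ∧ -1 ≤ a ∧ -1 ≤ b ∧ a ≤ ρ - 1 ∧ b ≤ ρ - 1 ∧ (a = -1 ∧ b = -1 ∨ a ≠ -1 ∧ b ≠ -1))
      ∨ (ε % 2 = 1 ∧ -1 ≤ a ∧ -1 ≤ b ∧ a ≤ ρ - 1 ∧ b ≤ ρ - 1 ∧ ((a = -1 ∧ 1 ≤ b) ∨ (b = -1 ∧ 1 ≤ a))))

theorem okst_sign {ρ a b ε : ℤ} (h : okst ρ a b ε) (j c : ℤ)
    (hc : c = ρ * (2 * j + ε) + b - a ∨ c = ρ * (2 * j + ε) + b + a) :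
    (0 ≤ c ∧ 0 ≤ 2 * j + ε) ∨ (c ≤ 0 ∧ 2 * j + ε ≤ 0) := by
  apply sign_aux' ρ a b _ h.1 _ c hc
  have := h.2
  omega

theorem WW_burge (ht : t ≠ 0) (hq : ∀ n, qp t n ≠ 0) (ρ a b ε w x : ℤ) (hx : 0 ≤ x)
    (hok : okst ρ a b ε) (B : ℕ) (hB : x < B) :
    ∑ y ∈ Finset.range B, (t ^ ((x - y) ^ 2) * gaussHalf t (w + y) x) * WW t ρ a b ε x y
      = WW t (ρ + 1) a b ε w x := by
  unfold WW
  rw [Finset.sum_congr rfl (fun y _ => mul_finsum _ _),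
    ← finsum_sum_comm]
  · apply finsum_congr
    intro j
    have e1 := burge ht hq w x _ _ hx (okst_sign hok j _ (Or.inl rfl)) B hB
    have e2 := burge ht hq w x _ _ hx (okst_sign hok j _ (Or.inr rfl)) B hB
    set β := 2 * j + ε
    rw [show ρ * β + b - a + β = (ρ + 1) * β + b - a by ring] at e1
    rw [show ρ * β + b + a + β = (ρ + 1) * β + b + a by ring] at e2
    rw [show (ρ + 1) * β ^ 2 + 2 * b * β + b - a = (ρ * β ^ 2 + 2 * b * β + b - a) + β ^ 2 by ring,
      zpow_add₀ ht]
    generalize t ^ (ρ * β ^ 2 + 2 * b * β + b - a) = P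
    rw [mul_assoc, mul_sub (t ^ (β ^ 2)), ← e1, ← e2, ← Finset.sum_sub_distrib,
      Finset.mul_sum]
    apply Finset.sum_congr rfl
    intro y _
    ring
  · intro y _
    refine Set.Finite.subset (fs_WW (t := t) ρ a b ε x y) ?_
    intro j hj
    exact right_ne_zero_of_mul hj

theorem WW_insA (ht : t ≠ 0) (hq : ∀ n, qp t n ≠ 0) (ρ b ε x y : ℤ) (hx : 0 ≤ x) (hρ : 1 ≤ ρ)
    (h : (b = -1 ∧ ε % 2 = 0) ∨ (1 ≤ b ∧ b ≤ ρ - 1 ∧ ε % 2 = 1)) :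
    WW t ρ (-1) b ε (x + 1) y = t ^ (2 * y + 2) * WW t ρ (ρ - 1) b (ε + 1) x y := by
  rw [WW_split t ρ (ρ - 1) b (ε + 1) x y, mul_sub, mul_finsum,
    mul_finsum]
  rw [← finsum_comp_equiv (Equiv.addRight (-1 : ℤ))
    (f := fun j : ℤ => t ^ (2 * y + 2) *
      (t ^ (ρ * (2 * j + (ε + 1)) ^ 2 + 2 * b * (2 * j + (ε + 1)) + b - (ρ - 1))
        * BB t x y (ρ * (2 * j + (ε + 1)) + b + (ρ - 1)) (2 * j + (ε + 1))))]
  rw [← finsum_sub_distrib]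
  · unfold WW
    apply finsum_congr
    intro j
    have e : 2 * (Equiv.addRight (-1 : ℤ) j) + (ε + 1) = (2 * j + ε) - 1 := by
      simp; ring
    simp only [e, show 2 * j + (ε + 1) = (2 * j + ε) + 1 by ring]
    have hβ : (b = -1 ∧ (2 * j + ε) % 2 = 0) ∨ (1 ≤ b ∧ b ≤ ρ - 1 ∧ (2 * j + ε) % 2 = 1) := by
      omega
    generalize 2 * j + ε = β at *
    have key := pairA ht hq x y (ρ * β + b - 1) β ?_ ?_
    · rw [show ρ * β + b - -1 = ρ * β + b - 1 + 2 by ring,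
        show ρ * β + b + -1 = ρ * β + b - 1 by ring,
        show ρ * (β + 1) + b - (ρ - 1) = ρ * β + b - 1 + 2 by ring,
        show ρ * (β - 1) + b + (ρ - 1) = ρ * β + b - 1 by ring]
      have g1 : t ^ (2 * y + 2) * t ^ (ρ * (β + 1) ^ 2 + 2 * b * (β + 1) + b - (ρ - 1))
          = t ^ (ρ * β ^ 2 + 2 * b * β + b - -1) * t ^ (2 * (y + (ρ * β + b - 1)) + 4) := by
        rw [← zpow_add₀ ht, ← zpow_add₀ ht]; congr 1; ring
      have g2 : t ^ (2 * y + 2) * t ^ (ρ * (β - 1) ^ 2 + 2 * b * (β - 1) + b - (ρ - 1))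
          = t ^ (ρ * β ^ 2 + 2 * b * β + b - -1) * t ^ (2 * (y - (ρ * β + b - 1))) := by
        rw [← zpow_add₀ ht, ← zpow_add₀ ht]; congr 1; ring
      rw [← mul_assoc, ← mul_assoc, g1, g2]
      generalize t ^ (ρ * β ^ 2 + 2 * b * β + b - -1) = P at *
      linear_combination (-P) * key
    · rintro ⟨h1, h2, h3, h4⟩
      have h5 : β ≤ 0 := by linarith
      rcases hβ with ⟨rfl, hp⟩ | ⟨hb, hb2, hp⟩
      · have : ρ * β ≤ 0 := by nlinarith
        linarith
      · have : β ≤ -1 := by omega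
        have : ρ * β ≤ ρ * (-1) := by gcongr
        linarith
    · rintro ⟨h1, h2, h3, h4⟩
      have h5 : 0 ≤ β := by linarith
      rcases hβ with ⟨rfl, hp⟩ | ⟨hb, hb2, hp⟩
      · have : ρ * β ≥ β := by nlinarith
        linarith
      · have : 1 ≤ β := by omega
        have : ρ * 1 ≤ ρ * β := by gcongr
        linarith
  · simp only [← mul_assoc]
    exact fs_BB _ _ _ _ _
  · simp only [← mul_assoc]
    have := fs_BB (t := t) x y (ε - 1) (fun j => t ^ (2 * y + 2) *
      t ^ (ρ * (2 * j + (ε - 1)) ^ 2 + 2 * b * (2 * j + (ε - 1)) + b - (ρ - 1)))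
        (fun j => ρ * (2 * j + (ε - 1)) + b + (ρ - 1))
    have e : ∀ j, 2 * (Equiv.addRight (-1 : ℤ) j) + (ε + 1) = 2 * j + (ε - 1) := by
      intro j; simp; ring
    simp only [e]
    exact this

theorem WW_insB (ht : t ≠ 0) (hq : ∀ n, qp t n ≠ 0) (ρ a ε x y : ℤ) (hx : 0 ≤ x) (hρ : 1 ≤ ρ)
    (h : (a = -1 ∧ ε % 2 = 0) ∨ (1 ≤ a ∧ a ≤ ρ - 1 ∧ ε % 2 = 1)) :
    WW t ρ a (-1) ε (x + 1) y = t ^ (-2 : ℤ) * WW t ρ a (ρ - 1) (ε + 1) x y := by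
  rw [WW_split t ρ a (ρ - 1) (ε + 1) x y, mul_sub, mul_finsum,
    mul_finsum, WW_split t ρ a (-1) ε]
  rw [← finsum_comp_equiv (Equiv.subLeft (-ε : ℤ))
    (f := fun j : ℤ => t ^ (ρ * (2 * j + ε) ^ 2 + 2 * (-1) * (2 * j + ε) + (-1) - a)
        * BB t (x + 1) y (ρ * (2 * j + ε) + (-1) + a) (2 * j + ε))]
  rw [← finsum_comp_equiv (Equiv.subLeft (-ε - 1 : ℤ))
    (f := fun j : ℤ => t ^ (-2 : ℤ) * (t ^ (ρ * (2 * j + (ε + 1)) ^ 2 + 2 * (ρ - 1) * (2 * j + (ε + 1)) + (ρ - 1) - a)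
        * BB t x y (ρ * (2 * j + (ε + 1)) + (ρ - 1) + a) (2 * j + (ε + 1))))]
  rw [← finsum_comp_equiv (Equiv.addRight (-1 : ℤ))
    (f := fun j : ℤ => t ^ (-2 : ℤ) *
      (t ^ (ρ * (2 * j + (ε + 1)) ^ 2 + 2 * (ρ - 1) * (2 * j + (ε + 1)) + (ρ - 1) - a)
        * BB t x y (ρ * (2 * j + (ε + 1)) + (ρ - 1) - a) (2 * j + (ε + 1))))]
  have E1 : ∀ j, 2 * (Equiv.addRight (-1 : ℤ) j) + (ε + 1) = (2 * j + ε) - 1 := by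
    intro j; simp; ring
  have E2 : ∀ j, 2 * (Equiv.subLeft (-ε - 1 : ℤ) j) + (ε + 1) = -(2 * j + ε + 1) := by
    intro j; simp; ring
  have E3 : ∀ j, 2 * (Equiv.subLeft (-ε : ℤ) j) + ε = -(2 * j + ε) := by
    intro j; simp; ring
  simp only [E1, E2, E3]
  have F1 : ∀ j, BB t x y (ρ * -(2 * j + ε + 1) + (ρ - 1) + a) (-(2 * j + ε + 1))
      = BB t x y (ρ * (2 * j + ε) + 1 - a) (2 * j + (ε + 1)) := by
    intro j; rw [← BB_neg]; congr 1 <;> ring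
  have F2 : ∀ j, BB t (x + 1) y (ρ * -(2 * j + ε) + (-1) + a) (-(2 * j + ε))
      = BB t (x + 1) y (ρ * (2 * j + ε) + 1 - a) (2 * j + ε) := by
    intro j; rw [← BB_neg]; congr 1 <;> ring
  simp only [F1, F2]
  have F3 : ∀ j, BB t x y (ρ * (2 * j + ε - 1) + (ρ - 1) - a) (2 * j + ε - 1)
      = BB t x y (ρ * (2 * j + ε) - 1 - a) (2 * j + (ε - 1)) := by
    intro j; congr 1 <;> ring
  simp only [F3]
  rw [← finsum_sub_distrib (fs_BB _ _ _ _ _) (fs_BB _ _ _ _ _), ← finsum_sub_distrib]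
  · apply finsum_congr
    intro j
    simp only [show 2 * j + (ε + 1) = (2 * j + ε) + 1 by ring,
      show 2 * j + (ε - 1) = (2 * j + ε) - 1 by ring]
    have hβ : (a = -1 ∧ (2 * j + ε) % 2 = 0) ∨ (1 ≤ a ∧ a ≤ ρ - 1 ∧ (2 * j + ε) % 2 = 1) := by
      omega
    generalize 2 * j + ε = β at *
    have key := pairB ht hq x y (ρ * β - 1 - a) β ?_ ?_
    · rw [show ρ * β + -1 - a = ρ * β - 1 - a by ring,
        show ρ * β + 1 - a = ρ * β - 1 - a + 2 by ring]
      have g1 : t ^ (ρ * (-β) ^ 2 + 2 * -1 * -β + -1 - a)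
        = t ^ (ρ * β ^ 2 + 2 * -1 * β + -1 - a) * t ^ (4 * β) := by
        rw [← zpow_add₀ ht]; congr 1; ring
      have g2 : t ^ (-2 : ℤ) * (t ^ (ρ * (β - 1) ^ 2 + 2 * (ρ - 1) * (β - 1) + (ρ - 1) - a)
          * BB t x y (ρ * β - 1 - a) (β - 1))
        = t ^ (ρ * β ^ 2 + 2 * -1 * β + -1 - a) * BB t x y (ρ * β - 1 - a) (β - 1) := by
        rw [← mul_assoc, ← zpow_add₀ ht]; congr 2; ring
      have g3 : ∀ z : K, t ^ (-2 : ℤ)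
          * (t ^ (ρ * (-(β + 1)) ^ 2 + 2 * (ρ - 1) * -(β + 1) + (ρ - 1) - a) * z)
        = t ^ (ρ * β ^ 2 + 2 * -1 * β + -1 - a) * t ^ (4 * β) * z := by
        intro z
        rw [← mul_assoc, ← zpow_add₀ ht, ← zpow_add₀ ht]; congr 2; ring
      rw [g1, g2, g3]
      generalize t ^ (ρ * β ^ 2 + 2 * -1 * β + -1 - a) = P at *
      linear_combination P * key
    · rintro ⟨h1, h2, h3, h4⟩
      have h5 : β ≤ 0 := by linarith
      rcases hβ with ⟨rfl, hp⟩ | ⟨hb, hb2, hp⟩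
      · have : ρ * β ≤ β := by nlinarith
        linarith
      · have : β ≤ -1 := by omega
        have : ρ * β ≤ ρ * (-1) := by gcongr
        linarith
    · rintro ⟨h1, h2, h3, h4⟩
      have h5 : 0 ≤ β := by linarith
      rcases hβ with ⟨rfl, hp⟩ | ⟨hb, hb2, hp⟩
      · have : ρ * β ≥ β := by nlinarith
        linarith
      · have : 1 ≤ β := by omega
        have : ρ * 1 ≤ ρ * β := by gcongr
        linarith
  · simp only [← mul_assoc]
    exact fs_BB _ _ _ _ _
  · simp only [← mul_assoc]
    exact fs_BB _ _ _ _ _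

theorem WW_base (ht : t ≠ 0) (hq : ∀ n, qp t n ≠ 0) (x y : ℕ) :
    WW t 1 (-1) (-1) 0 x y = if x = 0 ∧ y = 0 then 1 else 0 := by
  obtain _ | x := x
  · unfold WW
    rw [finsum_eq_single _ 0]
    · simp only [mul_zero, add_zero, zero_pow two_ne_zero]
      by_cases hy : y = 0
      · subst hy
        have : BB t 0 0 (-2) 0 = 0 := by
          by_contra h
          have := BB_ne_zero h
          omega
        simp [this]
        rw [BB_of (u := 0) (k := 0) (by simp) (by simp)]
        simp [gauss, qp]
      · rw [if_neg (by simp [hy])]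
        have h1 : ∀ α, BB t 0 y α 0 = 0 := by
          intro α
          by_contra h
          have := BB_ne_zero h
          omega
        simp [h1]
    · intro j hj
      have h1 : ∀ α, BB t 0 y α (2 * j) = 0 := by
        intro α
        by_contra h
        have := BB_ne_zero h
        omega
      simp [h1]
  · rw [if_neg (by simp)]
    push_cast
    rw [WW_insA ht hq 1 (-1) 0 x y (by simp) le_rfl (by simp)]
    unfold WW
    simp

end Wsec

section Phi

variable {t : K}

/-- indicator of equality -/
def ie (a n : ℕ) : ℤ := if a = n then 1 else 0
/-- indicator of `a ≤ n` -/
def ii (a n : ℕ) : ℤ := if a ≤ n then 1 else 0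
/-- current label, `-1` if pending -/
def st (a n : ℕ) : ℤ := if a ≤ n then a else -1

/-- The recursively defined fermionic kernel. -/
def PH (t : K) (a b B : ℕ) : ℕ → ℕ → ℕ → K
  | 0, w, x => if w = 0 ∧ x = 0 then 1 else 0
  | n + 1, w, x => t ^ (-2 * (x : ℤ) * ie a (n + 1)) * ∑ y ∈ Finset.range B,
      (t ^ (((x : ℤ) - y) ^ 2) * gaussHalf t ((w : ℤ) + ie a (n + 1) + ie b (n + 1) + y) x)
        * PH t a b B n x y

theorem stepA (ht : t ≠ 0) (hq : ∀ n, qp t n ≠ 0) (a n : ℕ) (b' ε w x : ℤ) (hw : 0 ≤ w)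
    (h : a = n + 1 → (b' = -1 ∧ ε % 2 = 0) ∨ (1 ≤ b' ∧ b' ≤ n + 1 ∧ ε % 2 = 1)) :
    t ^ (-2 * x * ie a (n + 1)) * WW t ((n : ℤ) + 2) (st a n) b' ε (w + ie a (n + 1)) x
      = t ^ (2 * ie a (n + 1)) * WW t (n + 2) (st a (n + 1)) b' (ε + ie a (n + 1)) w x := by
  unfold ie st
  by_cases ha : a = n + 1
  · rw [if_pos ha, if_neg (by omega), if_pos (by omega),
      WW_insA ht hq _ _ _ _ _ hw (by omega) (by have := h ha; omega), ← mul_assoc, ← zpow_add₀ ht]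
    subst ha
    push_cast
    congr 2 <;> ring
  · rw [if_neg ha]
    have : (if a ≤ n then (a : ℤ) else -1) = if a ≤ n + 1 then (a : ℤ) else -1 := by
      split_ifs <;> omega
    rw [this]
    simp

theorem stepB (ht : t ≠ 0) (hq : ∀ n, qp t n ≠ 0) (b n : ℕ) (a' ε w x : ℤ) (hw : 0 ≤ w)
    (h : b = n + 1 → (a' = -1 ∧ ε % 2 = 0) ∨ (1 ≤ a' ∧ a' ≤ n + 1 ∧ ε % 2 = 1)) :
    WW t ((n : ℤ) + 2) a' (st b n) ε (w + ie b (n + 1)) x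
      = t ^ (-2 * ie b (n + 1)) * WW t (n + 2) a' (st b (n + 1)) (ε + ie b (n + 1)) w x := by
  unfold ie st
  by_cases hb : b = n + 1
  · rw [if_pos hb, if_neg (by omega), if_pos (by omega),
      WW_insB ht hq _ _ _ _ _ hw (by omega) (by have := h hb; omega)]
    subst hb
    push_cast
    congr 2; ring
  · rw [if_neg hb]
    have : (if b ≤ n then (b : ℤ) else -1) = if b ≤ n + 1 then (b : ℤ) else -1 := by
      split_ifs <;> omega
    rw [this]
    simp

theorem ii_succ (a n : ℕ) : ii a (n + 1) = ii a n + ie a (n + 1) := by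
  unfold ii ie
  split_ifs <;> omega

theorem ie_nonneg (a n : ℕ) : 0 ≤ ie a n := by unfold ie; split_ifs <;> simp

theorem PH_eq (ht : t ≠ 0) (hq : ∀ n, qp t n ≠ 0) (a b B : ℕ) (ha : 1 ≤ a) (hb : 1 ≤ b) (n : ℕ) :
    ∀ w x : ℕ, x < B → PH t a b B n w x
      = t ^ (2 * ii a n - 2 * ii b n) * WW t (n + 1) (st a n) (st b n) (ii a n + ii b n) w x := by
  induction n with
  | zero =>
    intro w x _
    have h1 : ii a 0 = 0 := if_neg (by omega)
    have h2 : ii b 0 = 0 := if_neg (by omega)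
    have h3 : st a 0 = -1 := if_neg (by omega)
    have h4 : st b 0 = -1 := if_neg (by omega)
    rw [h1, h2, h3, h4]
    have := WW_base ht hq w x
    simp only [PH, ← this]
    simp
  | succ n ih =>
    intro w x hx
    have hok : okst ((n : ℤ) + 1) (st a n) (st b n) (ii a n + ii b n) := by
      unfold okst st ii
      split_ifs <;> omega
    rw [PH]
    have e1 : ∀ y ∈ Finset.range B, (t ^ (((x : ℤ) - y) ^ 2)
          * gaussHalf t ((w : ℤ) + ie a (n + 1) + ie b (n + 1) + y) x) * PH t a b B n x y
        = t ^ (2 * ii a n - 2 * ii b n) * ((t ^ (((x : ℤ) - y) ^ 2)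
          * gaussHalf t ((w : ℤ) + ie a (n + 1) + ie b (n + 1) + y) x)
            * WW t (n + 1) (st a n) (st b n) (ii a n + ii b n) x y) := by
      intro y hy
      rw [ih x y (Finset.mem_range.1 hy)]
      ring
    rw [Finset.sum_congr rfl e1, ← Finset.mul_sum,
      WW_burge ht hq _ _ _ _ _ _ (by omega) hok B (by omega),
      show ((n : ℤ) + 1 + 1) = n + 2 by ring]
    have e2 := stepA ht hq a n (st b n) (ii a n + ii b n) (w + ie b (n + 1)) x
      (by have := ie_nonneg b (n + 1); omega) (by
        intro h
        unfold st ii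
        split_ifs <;> omega)
    have e3 := stepB ht hq b n (st a (n + 1)) (ii a n + ii b n + ie a (n + 1)) w x
      (by omega) (by
        intro h
        unfold st ii ie
        split_ifs <;> omega)
    rw [mul_left_comm, show (w : ℤ) + ie a (n + 1) + ie b (n + 1)
      = w + ie b (n + 1) + ie a (n + 1) by ring, e2, e3, ← mul_assoc, ← mul_assoc,
      ← zpow_add₀ ht, ← zpow_add₀ ht, ii_succ, ii_succ]
    push_cast
    congr 1
    · congr 1; ring
    · congr 1 <;> ring

theorem WW_final (ht : t ≠ 0) (hq : ∀ n, qp t n ≠ 0) (ρ a b ε x : ℤ) (hx : 0 ≤ x)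
    (hok : okst ρ a b ε) (B : ℕ) (hB : x < B) :
    ∑ y ∈ Finset.range B, t ^ ((y : ℤ) ^ 2) * WW t ρ a b ε x y
      = ∑ᶠ j : ℤ, t ^ (ρ * (2 * j + ε) ^ 2 + 2 * b * (2 * j + ε) + b - a)
        * (t ^ ((ρ * (2 * j + ε) + b - a) ^ 2)
              * gg t (2 * x) (x + (ρ + 1) * (2 * j + ε) + b - a)
            - t ^ ((ρ * (2 * j + ε) + b + a) ^ 2)
              * gg t (2 * x) (x + (ρ + 1) * (2 * j + ε) + b + a)) := by
  unfold WW
  rw [Finset.sum_congr rfl (fun y _ => mul_finsum _ _), ← finsum_sum_comm]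
  · apply finsum_congr
    intro j
    have e1 := final_vand ht hq x _ _ hx (okst_sign hok j _ (Or.inl rfl)) B hB
    have e2 := final_vand ht hq x _ _ hx (okst_sign hok j _ (Or.inr rfl)) B hB
    set β := 2 * j + ε
    rw [show x + (ρ * β + b - a) + β = x + (ρ + 1) * β + b - a by ring] at e1
    rw [show x + (ρ * β + b + a) + β = x + (ρ + 1) * β + b + a by ring] at e2
    rw [← e1, ← e2, ← Finset.sum_sub_distrib, Finset.mul_sum]
    apply Finset.sum_congr rfl
    intro y _
    ring
  · intro y _
    refine Set.Finite.subset (fs_WW (t := t) ρ a b ε x y) ?_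
    intro j hj
    exact right_ne_zero_of_mul hj

theorem gg_ne_zero {N m : ℤ} (h : gg t N m ≠ 0) : 0 ≤ m ∧ m ≤ N := by
  unfold gg at h
  split_ifs at h with h1
  · have := gauss_ne_zero h
    omega
  · exact absurd rfl h

theorem fs_gg (x c r : ℤ) (hr : 1 ≤ r) (f : ℤ → K) :
    Function.HasFiniteSupport (fun j => f j * gg t (2 * x) (x + 2 * r * j + c)) := by
  refine (Set.finite_Icc (-(|x| + |c|)) (|x| + |c|)).subset ?_
  intro j hj
  have h := gg_ne_zero (right_ne_zero_of_mul hj)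
  have h1 := le_abs_self c
  have h2 := neg_abs_le c
  have h3 := le_abs_self x
  have h4 : 0 ≤ x := by linarith
  rw [Set.mem_Icc]
  constructor
  · by_contra hc
    push Not at hc
    have : r * j ≤ j := by nlinarith
    linarith
  · by_contra hc
    push Not at hc
    have : j ≤ r * j := by nlinarith [abs_nonneg x, abs_nonneg c]
    linarith

/-- The bosonic side of the finite identity. -/
def bosF (t : K) (r a b L : ℤ) : K :=
  (∑ᶠ j : ℤ, t ^ (4 * (j * ((r - 1) * r * j + r * b - (r - 1) * a)))
      * gg t (2 * L) (L + 2 * r * j + (b - a)))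
    - ∑ᶠ j : ℤ, t ^ (4 * ((j * (r - 1) + b) * (j * r + a)))
      * gg t (2 * L) (L + 2 * r * j + (b + a))

theorem melzer (ht : t ≠ 0) (hq : ∀ n, qp t n ≠ 0) (a b B n L : ℕ) (ha : 1 ≤ a) (hb : 1 ≤ b)
    (ha' : a ≤ n + 1) (hb' : b ≤ n) (hL : L < B) :
    ∑ x ∈ Finset.range B, t ^ ((x : ℤ) ^ 2) * PH t a b B n L x
      = t ^ (((a : ℤ) - b) * (a - b - 1)) * bosF t (n + 2) a b L := by
  rw [Finset.sum_congr rfl (fun x hx => by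
    rw [PH_eq ht hq a b B ha hb n L x (Finset.mem_range.1 hx), mul_left_comm]), ← Finset.mul_sum,
    WW_final ht hq _ _ _ _ _ (by omega) (by
      unfold okst st ii
      split_ifs <;> omega) B (by omega)]
  unfold bosF
  have hb1 : st b n = b := if_pos hb'
  have hb2 : ii b n = 1 := if_pos hb'
  rw [hb1, hb2, mul_sub, mul_finsum, mul_finsum, mul_finsum]
  have hf1 := fs_gg (t := t) L (b - a) (n + 2) (by omega)
    (fun j => t ^ (((a : ℤ) - b) * (a - b - 1))
      * t ^ (4 * (j * (((n : ℤ) + 2 - 1) * (n + 2) * j + (n + 2) * b - (n + 2 - 1) * a))))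
  have hf2 := fs_gg (t := t) L (b + a) (n + 2) (by omega)
    (fun j => t ^ (((a : ℤ) - b) * (a - b - 1))
      * t ^ (4 * ((j * ((n : ℤ) + 2 - 1) + b) * (j * (n + 2) + a))))
  simp only [mul_assoc (t ^ (((a : ℤ) - b) * (a - b - 1)))] at hf1 hf2
  set F1 : ℤ → K := fun j => t ^ (((a : ℤ) - b) * (a - b - 1))
      * (t ^ (4 * (j * (((n : ℤ) + 2 - 1) * (n + 2) * j + (n + 2) * b - (n + 2 - 1) * a)))
      * gg t (2 * L) (L + 2 * (n + 2) * j + (b - a))) with hF1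
  by_cases h : a ≤ n
  · have ha1 : st a n = a := if_pos h
    have ha2 : ii a n = 1 := if_pos h
    rw [ha1, ha2, ← finsum_comp_equiv (Equiv.addRight (1 : ℤ)) (f := F1), ← finsum_comp_equiv
      (Equiv.addRight (1 : ℤ)) (f := fun j => t ^ (((a : ℤ) - b) * (a - b - 1))
      * (t ^ (4 * ((j * ((n : ℤ) + 2 - 1) + b) * (j * (n + 2) + a)))
      * gg t (2 * L) (L + 2 * (n + 2) * j + (b + a)))), ← finsum_sub_distrib]
    · apply finsum_congr
      intro j
      simp only [hF1, Equiv.coe_addRight, ← mul_assoc, mul_sub, ← zpow_add₀ ht]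
      congr 3 <;> ring
    · have hh := Function.HasFiniteSupport.comp_of_injective (Equiv.addRight (1 : ℤ)).injective hf1
      exact hh
    · have hh := Function.HasFiniteSupport.comp_of_injective (Equiv.addRight (1 : ℤ)).injective hf2
      exact hh
  · have ha1 : st a n = -1 := if_neg h
    have ha2 : ii a n = 0 := if_neg h
    have ha3 : (a : ℤ) = n + 1 := by omega
    rw [ha1, ha2, ← finsum_comp_equiv (Equiv.addRight (1 : ℤ)) (f := F1), ← finsum_sub_distrib]
    · apply finsum_congr
      intro j
      simp only [hF1, Equiv.coe_addRight, ← mul_assoc, mul_sub, ← zpow_add₀ ht]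
      rw [ha3]
      congr 3 <;> ring
    · have hh := Function.HasFiniteSupport.comp_of_injective (Equiv.addRight (1 : ℤ)).injective hf1
      exact hh
    · exact hf2

end Phi

section Unroll

variable {t : K}

/-- first entry (zero for the empty vector) -/
def hd : {n : ℕ} → (Fin n → ℕ) → ℕ
  | 0, _ => 0
  | _ + 1, m => m 0

theorem hd_succ {n : ℕ} (m : Fin (n + 1) → ℕ) : hd m = m 0 := rfl

/-- The box of vectors with entries `< B`. -/
def box (n B : ℕ) : Finset (Fin n → ℕ) := Fintype.piFinset fun _ => Finset.range B

/-- unrolled kernel -/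
def PS (t : K) (a b : ℕ) : (n : ℕ) → ℕ → (Fin n → ℕ) → K
  | 0, w, _ => if ((w : ℤ) + ie a 1 + ie b 1) % 2 = 0 then 1 else 0
  | n + 1, w, m => t ^ (-2 * (m 0 : ℤ) * ie a (n + 2)) *
      (t ^ (((m 0 : ℤ) - hd (Fin.tail m)) ^ 2)
        * gaussHalf t ((w : ℤ) + ie a (n + 2) + ie b (n + 2) + hd (Fin.tail m)) (m 0))
      * PS t a b n (m 0) (Fin.tail m)

theorem sum_box_succ (n B : ℕ) (F : (Fin (n + 1) → ℕ) → K) :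
    ∑ m ∈ box (n + 1) B, F m = ∑ x ∈ Finset.range B, ∑ m ∈ box n B, F (Fin.cons x m) := by
  rw [← Finset.sum_product']
  apply Finset.sum_nbij' (fun m => (m 0, Fin.tail m)) (fun p => Fin.cons p.1 p.2)
  · intro m hm
    simp only [box, Fintype.mem_piFinset, Finset.mem_product] at hm ⊢
    exact ⟨hm 0, fun i => hm i.succ⟩
  · intro p hp
    simp only [box, Fintype.mem_piFinset, Finset.mem_product] at hp ⊢
    intro i
    refine Fin.cases ?_ ?_ i
    · simpa using hp.1
    · intro i; simpa using hp.2 i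
  · intro m _; exact Fin.cons_self_tail m
  · intro p _; simp
  · intro m _; rw [Fin.cons_self_tail]

theorem ie_one_nonneg (w a b n : ℕ) : 0 ≤ (w : ℤ) + ie a n + ie b n := by
  have := ie_nonneg a n
  have := ie_nonneg b n
  omega

theorem unroll (hq : ∀ n, qp t n ≠ 0) (a b B : ℕ) (hB : 0 < B) (n : ℕ) :
    ∀ (w : ℕ) (g : ℕ → K), ∑ x ∈ Finset.range B, g x * PH t a b B (n + 1) w x
      = ∑ m ∈ box n B, g (hd m) * PS t a b n w m := by
  induction n with
  | zero =>
    intro w g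
    rw [Finset.sum_eq_single_of_mem 0 (Finset.mem_range.2 hB)]
    · have : box 0 B = {Fin.elim0} := by
        ext m
        simp only [box, Fintype.mem_piFinset, Finset.mem_singleton]
        exact ⟨fun _ => Subsingleton.elim _ _, fun _ i => i.elim0⟩
      rw [this, Finset.sum_singleton]
      simp only [PH, hd, PS]
      rw [Finset.sum_eq_single_of_mem 0 (Finset.mem_range.2 hB)]
      · simp only [CharP.cast_eq_zero, add_zero, gaussHalf]
        have := ie_one_nonneg w a b 1
        simp only [zero_add]
        split_ifs with h h' h'
        · rw [gauss_zero_right hq (by omega)]; simp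
        · exact absurd (And.intro trivial trivial) h'
        · simp
        · simp
      · intro y _ hy
        simp [hy]
    · intro x _ hx
      simp [PH, hx]
  | succ n ih =>
    intro w g
    rw [sum_box_succ]
    apply Finset.sum_congr rfl
    intro x _
    rw [PH, ih x (fun y => t ^ (((x : ℤ) - y) ^ 2)
      * gaussHalf t ((w : ℤ) + ie a (n + 2) + ie b (n + 2) + y) x), Finset.mul_sum, Finset.mul_sum]
    apply Finset.sum_congr rfl
    intro m _
    simp only [PS, hd, Fin.cons_zero, Fin.tail_cons]
    ring

theorem sum_hd {n : ℕ} (m : Fin n → ℕ) :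
    ∑ k : Fin n, (if (k : ℕ) = 0 then (m k : ℤ) else 0) = hd m := by
  obtain _ | n := n
  · simp [hd]
  · rw [Fin.sum_univ_succ]
    simp [hd]

theorem cartan_succ (n : ℕ) (i k : Fin n) : cartan (n + 1) i.succ k.succ = cartan n i k := by
  simp [cartan, inc]

theorem cartan_zero_succ (n : ℕ) (k : Fin n) :
    cartan (n + 1) 0 k.succ = if (k : ℕ) = 0 then -1 else 0 := by
  have : ¬ ((0 : Fin (n + 1)) = k.succ) := (Fin.succ_ne_zero k).symm
  simp [cartan, inc, this]
  split_ifs <;> simp_all <;> omega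

theorem cartan_succ_zero (n : ℕ) (k : Fin n) :
    cartan (n + 1) k.succ 0 = if (k : ℕ) = 0 then -1 else 0 := by
  have : ¬ (k.succ = (0 : Fin (n + 1))) := Fin.succ_ne_zero k
  simp [cartan, inc, this]
  split_ifs <;> simp_all

theorem quadC_succ (n : ℕ) (m : Fin (n + 1) → ℕ) :
    quadC (n + 1) m = 2 * (m 0 : ℤ) ^ 2 - 2 * m 0 * hd (Fin.tail m) + quadC n (Fin.tail m) := by
  unfold quadC
  rw [Fin.sum_univ_succ, Fin.sum_univ_succ]
  simp only [Fin.sum_univ_succ (n := n), Finset.sum_add_distrib, cartan_succ, cartan_zero_succ,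
    cartan_succ_zero]
  have h0 : cartan (n + 1) 0 0 = 2 := by simp [cartan, inc]
  have h1 : ∑ k : Fin n, (m 0 : ℤ) * (if (k : ℕ) = 0 then -1 else 0) * (m k.succ)
      = - (m 0 * hd (Fin.tail m)) := by
    rw [← sum_hd, Finset.mul_sum, ← Finset.sum_neg_distrib]
    apply Finset.sum_congr rfl
    intro k _
    unfold Fin.tail
    split_ifs <;> simp
  have h2 : ∑ k : Fin n, (m k.succ : ℤ) * (if (k : ℕ) = 0 then -1 else 0) * (m 0)
      = - (m 0 * hd (Fin.tail m)) := by
    rw [← h1]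
    apply Finset.sum_congr rfl
    intro k _
    ring
  rw [h0, h1, h2]
  unfold Fin.tail
  ring

theorem mAt_succ (n : ℕ) (m : Fin (n + 1) → ℕ) (s : ℤ) :
    mAt (n + 1) m s = (if s = 1 then (m 0 : ℤ) else 0) + mAt n (Fin.tail m) (s - 1) := by
  unfold mAt
  rw [Fin.sum_univ_succ]
  congr 1
  · simp [uv, eq_comm]
  · apply Finset.sum_congr rfl
    intro k _
    have : uv (n + 1) s k.succ = uv n (s - 1) k := by
      unfold uv
      simp only [Fin.val_succ]
      push_cast
      split_ifs <;> omega
    rw [this]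
    rfl

theorem topC_zero (n a b : ℕ) (c : ℤ) (m : Fin (n + 1) → ℕ) :
    topC (n + 4) a b c m (0 : Fin (n + 1))
      = c + ie a (n + 2) + ie b (n + 2) + hd (Fin.tail m) := by
  have h : ∑ k : Fin (n + 1), inc (n + 1) 0 k * (m k : ℤ) = hd (Fin.tail m) := by
    rw [Fin.sum_univ_succ, ← sum_hd]
    have : inc (n + 1) 0 0 = 0 := by simp [inc]
    rw [this, zero_mul, zero_add]
    apply Finset.sum_congr rfl
    intro k _
    by_cases hk : (k : ℕ) = 0
    · simp [inc, Fin.tail, hk]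
    · have hk' : ¬ (0 = (k : ℕ)) := fun h => hk h.symm
      simp [inc, Fin.tail, hk, hk']
  have h1 : ∀ e : ℕ, uv (n + 1) (((n + 4 : ℕ) : ℤ) - e - 1) 0 = ie e (n + 2) := by
    intro e
    unfold uv ie
    simp only [Fin.val_zero]
    push_cast
    split_ifs <;> omega
  have h2 : uv (n + 1) 1 0 = 1 := by simp [uv]
  change (∑ k : Fin (n + 1), inc (n + 1) 0 k * (m k : ℤ)) + c * uv (n + 1) 1 0
    + uv (n + 1) (((n + 4 : ℕ) : ℤ) - a - 1) 0 + uv (n + 1) (((n + 4 : ℕ) : ℤ) - b - 1) 0 = _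
  rw [h, h1, h1, h2]
  ring

theorem topC_succ (n a b : ℕ) (c : ℤ) (m : Fin (n + 1) → ℕ) (i : Fin n) :
    topC (n + 4) a b c m (i.succ : Fin (n + 1)) = topC (n + 3) a b (m 0) (Fin.tail m) i := by
  have h1 : ∀ e : ℕ, uv (n + 1) (((n + 4 : ℕ) : ℤ) - e - 1) i.succ
      = uv n (((n + 3 : ℕ) : ℤ) - e - 1) i := by
    intro e
    unfold uv
    simp only [Fin.val_succ]
    push_cast
    split_ifs <;> omega
  have h2 : uv (n + 1) 1 i.succ = 0 := by
    unfold uv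
    simp only [Fin.val_succ]
    rw [if_neg (by omega)]
  have h3 : inc (n + 1) i.succ 0 = uv n 1 i := by
    by_cases hk : (i : ℕ) = 0
    · simp [inc, uv, hk]
    · simp [inc, uv, hk]
  have h4 : ∀ k : Fin n, inc (n + 1) i.succ k.succ = inc n i k := by
    intro k; simp [inc]
  change (∑ k : Fin (n + 1), inc (n + 1) i.succ k * (m k : ℤ)) + c * uv (n + 1) 1 i.succ
    + uv (n + 1) (((n + 4 : ℕ) : ℤ) - a - 1) i.succ
    + uv (n + 1) (((n + 4 : ℕ) : ℤ) - b - 1) i.succ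
    = (∑ k : Fin n, inc n i k * (Fin.tail m k : ℤ)) + (m 0 : ℤ) * uv n 1 i
    + uv n (((n + 3 : ℕ) : ℤ) - a - 1) i + uv n (((n + 3 : ℕ) : ℤ) - b - 1) i
  rw [Fin.sum_univ_succ, h1, h1, h2, h3]
  simp only [h4, Fin.tail]
  ring

/-- parity label -/
def qq (a b k : ℕ) : ℕ := min (a - 1) k + min (b - 1) k

theorem parity_succ (n a b : ℕ) (m : Fin (n + 1) → ℕ) :
    parity (n + 4) a b m ↔ (m 0 % 2 = qq a b (n + 1) % 2 ∧ parity (n + 3) a b (Fin.tail m)) := by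
  change (∀ i : Fin (n + 1), m i % 2 = (min (a - 1) (n + 4 - ((i : ℕ) + 1) - 2)
    + min (b - 1) (n + 4 - ((i : ℕ) + 1) - 2)) % 2) ↔ (_ ∧
    (∀ i : Fin n, Fin.tail m i % 2 = (min (a - 1) (n + 3 - ((i : ℕ) + 1) - 2)
    + min (b - 1) (n + 3 - ((i : ℕ) + 1) - 2)) % 2))
  rw [Fin.forall_fin_succ]
  simp only [Fin.val_zero, Fin.val_succ, qq, Fin.tail]
  have e1 : n + 4 - (0 + 1) - 2 = n + 1 := by omega
  have e2 : ∀ i : ℕ, n + 4 - (i + 1 + 1) - 2 = n + 3 - (i + 1) - 2 := by omega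
  simp only [e1, e2]

theorem parity_hd (n a b : ℕ) (m : Fin n → ℕ) (h : parity (n + 3) a b m) :
    hd m % 2 = qq a b n % 2 := by
  obtain _ | n := n
  · simp [hd, qq]
  · exact ((parity_succ n a b m).1 h).1

theorem PS_closed (ht : t ≠ 0) (a b : ℕ) (ha : 1 ≤ a) (hb : 1 ≤ b) (n : ℕ) :
    ∀ (w : ℕ) (m : Fin n → ℕ), PS t a b n w m
      = if w % 2 = qq a b (n + 1) % 2 ∧ parity (n + 3) a b m then
          t ^ (quadC n m - (hd m : ℤ) ^ 2 - 2 * mAt n m (((n + 3 : ℕ) : ℤ) - a - 1))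
            * ∏ i : Fin n, gaussHalf t (topC (n + 3) a b w m i) (m i)
        else 0 := by
  induction n with
  | zero =>
    intro w m
    have h1 : quadC 0 m = 0 := by simp [quadC]
    have h2 : ∀ s, mAt 0 m s = 0 := by simp [mAt]
    have h3 : parity (0 + 3) a b m := fun i => i.elim0
    simp only [PS, h1, h2, hd, h3, and_true, qq]
    have : ((w : ℤ) + ie a 1 + ie b 1) % 2 = 0
      ↔ w % 2 = (min (a - 1) (0 + 1) + min (b - 1) (0 + 1)) % 2 := by
      unfold ie
      split_ifs <;> omega
    simp only [this]
    simp
  | succ n ih =>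
    intro w m
    simp only [PS, ih, hd_succ]
    have hp := parity_succ n a b m
    by_cases h : m 0 % 2 = qq a b (n + 1) % 2 ∧ parity (n + 3) a b (Fin.tail m)
    · rw [if_pos h]
      have hp' := hp.2 h
      have h5 := parity_hd n a b _ h.2
      by_cases hw : w % 2 = qq a b (n + 2) % 2
      · rw [if_pos ⟨hw, hp'⟩, Fin.prod_univ_succ, topC_zero]
        simp only [topC_succ, quadC_succ, mAt_succ]
        have e : t ^ (2 * (m 0 : ℤ) ^ 2 - 2 * m 0 * hd (Fin.tail m) + quadC n (Fin.tail m)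
            - (m 0 : ℤ) ^ 2 - 2 * ((if ((n + 1 + 3 : ℕ) : ℤ) - a - 1 = 1 then (m 0 : ℤ) else 0)
              + mAt n (Fin.tail m) (((n + 1 + 3 : ℕ) : ℤ) - a - 1 - 1)))
          = t ^ (-2 * (m 0 : ℤ) * ie a (n + 2)) * t ^ (((m 0 : ℤ) - hd (Fin.tail m)) ^ 2)
            * t ^ (quadC n (Fin.tail m) - (hd (Fin.tail m) : ℤ) ^ 2
              - 2 * mAt n (Fin.tail m) (((n + 3 : ℕ) : ℤ) - a - 1)) := by
          rw [← zpow_add₀ ht, ← zpow_add₀ ht]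
          congr 1
          have e1 : (if ((n + 1 + 3 : ℕ) : ℤ) - a - 1 = 1 then (m 0 : ℤ) else 0)
              = m 0 * ie a (n + 2) := by
            unfold ie
            push_cast
            split_ifs <;> first | omega | simp
          have e2 : ((n + 1 + 3 : ℕ) : ℤ) - a - 1 - 1 = ((n + 3 : ℕ) : ℤ) - a - 1 := by
            push_cast; ring
          rw [e1, e2]
          ring
        rw [e]
        simp only [Fin.tail]
        ring
      · rw [if_neg (fun hh => hw hh.1)]
        have : gaussHalf t ((w : ℤ) + ie a (n + 2) + ie b (n + 2) + hd (Fin.tail m)) (m 0) = 0 := by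
          unfold gaussHalf
          rw [if_neg]
          unfold qq at hw h5
          unfold ie
          split_ifs <;> omega
        rw [this]
        simp
    · rw [if_neg h, if_neg (fun hh => h (hp.1 hh.2)), mul_zero]

/-- the summand of the theorem -/
def TG (t : K) (a b n : ℕ) (m : Fin n → ℕ) : K :=
  if parity (n + 3) a b m then
    t ^ (quadC n m - 2 * mAt n m (((n + 3 : ℕ) : ℤ) - a - 1))
      * (qp t (mAtN n m 1))⁻¹
      * ∏ i : Fin n, (if 1 ≤ (i : ℕ) then gaussHalf t (topC (n + 3) a b 0 m i) (m i) else 1)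
  else 0

theorem TG_succ (ht : t ≠ 0) (a b : ℕ) (ha : 1 ≤ a) (hb : 1 ≤ b) (n : ℕ) (m : Fin (n + 1) → ℕ) :
    TG t a b (n + 1) m = t ^ ((m 0 : ℤ) ^ 2) * (t ^ (-2 * (m 0 : ℤ) * ie a (n + 2))
      * (t ^ (((m 0 : ℤ) - hd (Fin.tail m)) ^ 2) * (qp t (m 0))⁻¹)
      * PS t a b n (m 0) (Fin.tail m)) := by
  rw [PS_closed ht a b ha hb]
  unfold TG
  simp only [parity_succ]
  by_cases h : m 0 % 2 = qq a b (n + 1) % 2 ∧ parity (n + 3) a b (Fin.tail m)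
  · rw [if_pos h, if_pos h, Fin.prod_univ_succ]
    have h1 : mAtN (n + 1) m 1 = m 0 := by
      unfold mAtN
      rw [Fin.sum_univ_succ]
      simp
    simp only [topC_succ, quadC_succ, mAt_succ, h1]
    have e : t ^ (2 * (m 0 : ℤ) ^ 2 - 2 * m 0 * hd (Fin.tail m) + quadC n (Fin.tail m)
            - 2 * ((if ((n + 1 + 3 : ℕ) : ℤ) - a - 1 = 1 then (m 0 : ℤ) else 0)
              + mAt n (Fin.tail m) (((n + 1 + 3 : ℕ) : ℤ) - a - 1 - 1)))
          = t ^ ((m 0 : ℤ) ^ 2) * t ^ (-2 * (m 0 : ℤ) * ie a (n + 2))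
            * t ^ (((m 0 : ℤ) - hd (Fin.tail m)) ^ 2)
            * t ^ (quadC n (Fin.tail m) - (hd (Fin.tail m) : ℤ) ^ 2
              - 2 * mAt n (Fin.tail m) (((n + 3 : ℕ) : ℤ) - a - 1)) := by
      rw [← zpow_add₀ ht, ← zpow_add₀ ht, ← zpow_add₀ ht]
      congr 1
      have e1 : (if ((n + 1 + 3 : ℕ) : ℤ) - a - 1 = 1 then (m 0 : ℤ) else 0)
          = m 0 * ie a (n + 2) := by
        unfold ie
        push_cast
        split_ifs <;> first | omega | simp
      have e2 : ((n + 1 + 3 : ℕ) : ℤ) - a - 1 - 1 = ((n + 3 : ℕ) : ℤ) - a - 1 := by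
        push_cast; ring
      rw [e1, e2]
      ring
    rw [e]
    simp [Fin.tail]
    ring
  · rw [if_neg h, if_neg h]
    simp

theorem TG_zero (a b : ℕ) (m : Fin 0 → ℕ) : TG t a b 0 m = 1 := by
  unfold TG
  have h : parity (0 + 3) a b m := fun i => i.elim0
  rw [if_pos h]
  simp [quadC, mAt, mAtN, qp]

end Unroll


/-! ### Laurent series -/

/-- Laurent series of order at least `n`. -/
def OO (n : ℤ) : AddSubgroup (LaurentSeries ℚ) where
  carrier := {x | Valued.v x ≤ WithZero.exp (-n)}
  zero_mem' := by simp
  add_mem' := by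
    intro x y hx hy
    exact (Valued.v.map_add x y).trans (max_le hx hy)
  neg_mem' := by
    intro x hx
    simpa only [Set.mem_ofPred_eq, Valuation.map_neg] using hx

theorem mem_OO (n : ℤ) (x : LaurentSeries ℚ) : x ∈ OO n ↔ Valued.v x ≤ WithZero.exp (-n) := Iff.rfl

theorem mem_OO' (n : ℤ) (x : LaurentSeries ℚ) : x ∈ OO n ↔ ∀ k < n, x.coeff k = 0 := by
  rw [mem_OO, LaurentSeries.valuation_le_iff_coeff_lt_eq_zero]

theorem OO_anti {m n : ℤ} (h : m ≤ n) {x : LaurentSeries ℚ} (hx : x ∈ OO n) : x ∈ OO m := by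
  rw [mem_OO'] at *
  intro k hk
  exact hx k (by omega)

theorem OO_mul {m n : ℤ} {x y : LaurentSeries ℚ} (hx : x ∈ OO m) (hy : y ∈ OO n) :
    x * y ∈ OO (m + n) := by
  rw [mem_OO] at *
  rw [map_mul, neg_add, WithZero.exp_add]
  exact mul_le_mul' hx hy

theorem OO_mul' {m n k : ℤ} {x y : LaurentSeries ℚ} (hx : x ∈ OO m) (hy : y ∈ OO n) (h : k ≤ m + n) :
    x * y ∈ OO k := OO_anti h (OO_mul hx hy)

theorem OO_eq_zero {x : LaurentSeries ℚ} (h : ∀ n : ℕ, x ∈ OO n) : x = 0 := by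
  ext k
  have := h (k.toNat + 1)
  rw [mem_OO'] at this
  exact this k (by push_cast; omega)

theorem OO_one : (1 : LaurentSeries ℚ) ∈ OO 0 := by
  rw [mem_OO]; simp

theorem tL_zpow (n : ℤ) : tL ^ n ∈ OO n := by
  rw [mem_OO]
  unfold tL
  have h : Valued.v (HahnSeries.single (1:ℤ) (1:ℚ) : LaurentSeries ℚ) = WithZero.exp (-1 : ℤ) := by
    simpa using LaurentSeries.valuation_single_zpow ℚ 1
  rw [map_zpow₀, h, ← WithZero.exp_zsmul]
  simp

theorem tL_pow (n : ℕ) : tL ^ n ∈ OO n := by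
  have := tL_zpow n
  simpa using this

theorem tL_ne_zero : tL ≠ 0 := by
  unfold tL
  simp

theorem OO_unit {x : LaurentSeries ℚ} (h : x - 1 ∈ OO 1) : Valued.v x = 1 := by
  rw [mem_OO] at h
  have h2 : Valued.v (x - 1) < 1 := by
    refine lt_of_le_of_lt h ?_
    rw [← WithZero.exp_zero, WithZero.exp_lt_exp]; norm_num
  have := Valuation.map_one_add_of_lt (v := Valued.v) h2
  simpa using this

theorem OO_unit_ne {x : LaurentSeries ℚ} (h : x - 1 ∈ OO 1) : x ≠ 0 := by
  intro h0
  have := OO_unit h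
  rw [h0] at this
  simp at this

theorem OO_unit_mem {x : LaurentSeries ℚ} (h : x - 1 ∈ OO 1) : x ∈ OO 0 := by
  rw [mem_OO, OO_unit h]; simp

theorem OO_unit_inv {x : LaurentSeries ℚ} (h : x - 1 ∈ OO 1) : x⁻¹ ∈ OO 0 := by
  rw [mem_OO, map_inv₀, OO_unit h]; simp

theorem OO_sum {ι : Type*} {n : ℤ} (s : Finset ι) (f : ι → LaurentSeries ℚ) (h : ∀ i ∈ s, f i ∈ OO n) :
    ∑ i ∈ s, f i ∈ OO n := AddSubgroup.sum_mem _ h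

theorem OO_prod {ι : Type*} {n : ℤ} (hn : 0 ≤ n) (s : Finset ι) (f : ι → LaurentSeries ℚ)
    (h : ∀ i ∈ s, f i - 1 ∈ OO n) : ∏ i ∈ s, f i - 1 ∈ OO n := by
  classical
  induction s using Finset.induction_on with
  | empty => simp
  | insert i s hi ih =>
    rw [Finset.prod_insert hi]
    have h1 : f i - 1 ∈ OO n := h i (by simp)
    have h2 := ih (fun j hj => h j (by simp [hj]))
    have h3 : f i ∈ OO 0 := by
      have := add_mem (OO_anti hn h1) OO_one
      simpa using this
    have : f i * ∏ i ∈ s, f i - 1 = f i * (∏ i ∈ s, f i - 1) + (f i - 1) := by ring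
    rw [this]
    exact add_mem (OO_mul' h3 h2 (by simp)) h1

theorem OO_nhds (n : ℤ) : (OO n : Set (LaurentSeries ℚ)) ∈ nhds (0 : LaurentSeries ℚ) := by
  rw [Valued.mem_nhds_zero]
  have h0 : Valued.v.restrict (tL ^ n) ≠ 0 := by
    rw [Valuation.ne_zero_iff]
    exact zpow_ne_zero _ tL_ne_zero
  refine ⟨Units.mk0 _ h0, ?_⟩
  intro x hx
  have hx' : Valued.v.restrict x < Valued.v.restrict (tL ^ n) := hx
  rw [Valuation.restrict_lt_iff] at hx'
  exact hx'.le.trans (tL_zpow n)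

theorem OO_basis (U : Set (LaurentSeries ℚ)) (hU : U ∈ nhds (0 : LaurentSeries ℚ)) :
    ∃ n : ℕ, (OO n : Set (LaurentSeries ℚ)) ⊆ U := by
  rw [Valued.mem_nhds_zero] at hU
  obtain ⟨γ, hγ⟩ := hU
  have h0 : MonoidWithZeroHom.ValueGroup₀.embedding γ.1 ≠ 0 := by
    simp
  obtain ⟨k, hk⟩ : ∃ k : ℤ, MonoidWithZeroHom.ValueGroup₀.embedding γ.1 = WithZero.exp k :=
    ⟨_, (WithZero.exp_log h0).symm⟩
  refine ⟨((-k).toNat + 1), ?_⟩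
  intro x hx
  apply hγ
  show Valued.v.restrict x < γ.1
  rw [Valuation.restrict_lt_iff_lt_embedding, hk]
  refine lt_of_le_of_lt hx ?_
  rw [WithZero.exp_lt_exp]
  push_cast
  omega

instance instNA : NonarchimedeanAddGroup (LaurentSeries ℚ) where
  is_nonarchimedean := by
    intro U hU
    obtain ⟨n, hn⟩ := OO_basis U hU
    exact ⟨⟨OO n, AddSubgroup.isOpen_of_mem_nhds _ (OO_nhds n)⟩, hn⟩

theorem OO_closed (n : ℤ) : IsClosed (OO n : Set (LaurentSeries ℚ)) :=
  AddSubgroup.isClosed_of_isOpen _ (AddSubgroup.isOpen_of_mem_nhds _ (OO_nhds n))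

theorem OO_summable {ι : Type*} (f : ι → LaurentSeries ℚ) (h : ∀ n : ℕ, {i | f i ∉ OO n}.Finite) :
    Summable f := by
  apply NonarchimedeanAddGroup.summable_of_tendsto_cofinite_zero
  intro U hU
  obtain ⟨n, hn⟩ := OO_basis U hU
  rw [Filter.mem_map, Filter.mem_cofinite]
  refine (h n).subset ?_
  intro i hi hmem
  exact hi (hn hmem)

theorem OO_tsum {ι : Type*} {n : ℤ} (f : ι → LaurentSeries ℚ) (h : ∀ i, f i ∈ OO n) :
    ∑' i, f i ∈ OO n := by
  by_cases hs : Summable f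
  · have := hs.hasSum
    exact (OO_closed n).mem_of_tendsto this (Filter.Eventually.of_forall fun s => OO_sum s f fun i _ => h i)
  · rw [tsum_eq_zero_of_not_summable hs]; exact zero_mem _

theorem OO_tendsto {ι : Type*} {l : Filter ι} (f : ι → LaurentSeries ℚ) (a : LaurentSeries ℚ)
    (h : ∀ n : ℕ, ∀ᶠ i in l, f i - a ∈ OO n) : Filter.Tendsto f l (nhds a) := by
  rw [← tendsto_sub_nhds_zero_iff]
  intro U hU
  obtain ⟨n, hn⟩ := OO_basis U hU
  filter_upwards [h n] with i hi
  exact hn hi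

/-! ### Euler product -/

theorem fac_OO (k : ℕ) : (1 - tL ^ (4 * (k + 1))) - 1 ∈ OO (4 * (k + 1)) := by
  have := tL_pow (4 * (k + 1))
  have h : (1 - tL ^ (4 * (k + 1))) - 1 = - tL ^ (4 * (k + 1)) := by ring
  rw [h]
  exact neg_mem (by exact_mod_cast this)

theorem qp_OO (n : ℕ) : qp tL n - 1 ∈ OO 1 := by
  unfold qp
  apply OO_prod (by norm_num)
  intro k _
  exact OO_anti (by omega) (fac_OO k)

theorem qp_tL_ne (n : ℕ) : qp tL n ≠ 0 := OO_unit_ne (qp_OO n)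

theorem prod_sub_qp (n : ℕ) (s : Finset ℕ) (hs : Finset.range n ⊆ s) :
    ∏ k ∈ s, (1 - tL ^ (4 * (k + 1))) - qp tL n ∈ OO (4 * (n + 1)) := by
  classical
  rw [← Finset.prod_sdiff hs]
  have : ∀ x : LaurentSeries ℚ, x * ∏ k ∈ Finset.range n, (1 - tL ^ (4 * (k + 1))) - qp tL n
      = (x - 1) * qp tL n := by
    intro x; unfold qp; ring
  rw [this]
  refine OO_mul' (OO_prod (n := 4 * (n + 1)) (by positivity) _ _ ?_) (OO_unit_mem (qp_OO n)) (by simp)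
  intro k hk
  simp at hk
  exact OO_anti (by omega) (fac_OO k)

theorem qp_diff (n k : ℕ) (h : n ≤ k) : qp tL k - qp tL n ∈ OO (4 * (n + 1)) :=
  prod_sub_qp n (Finset.range k) (by simpa using h)

theorem exists_lim : ∃ E : LaurentSeries ℚ, ∀ n : ℕ, E - qp tL n ∈ OO (4 * (n + 1)) := by
  have hs : Summable fun k => qp tL (k + 1) - qp tL k := by
    apply OO_summable
    intro n
    refine (Set.finite_lt_nat n).subset ?_
    intro k hk
    by_contra hlt
    simp only [Set.mem_ofPred_eq, not_lt] at hlt hk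
    exact hk (OO_anti (by omega) (qp_diff k (k + 1) (by omega)))
  refine ⟨1 + ∑' k, (qp tL (k + 1) - qp tL k), ?_⟩
  intro n
  rw [← hs.sum_add_tsum_nat_add n, Finset.sum_range_sub]
  have : ∀ x : LaurentSeries ℚ, 1 + (qp tL n - qp tL 0 + x) - qp tL n = x := by
    intro x
    have h0 : qp tL 0 = 1 := by simp [qp]
    rw [h0]
    ring
  rw [this]
  apply OO_tsum
  intro i
  exact OO_anti (by push_cast; omega) (qp_diff (i + n) (i + n + 1) (by omega))

theorem euler_sub (n : ℕ) : eulerInf - qp tL n ∈ OO (4 * (n + 1)) := by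
  obtain ⟨E, hE⟩ := exists_lim
  have : HasProd (fun k : ℕ => (1 - tL ^ (4 * (k + 1)))) E := by
    apply OO_tendsto
    intro n
    simp only [SummationFilter.unconditional_filter]
    filter_upwards [Filter.eventually_ge_atTop (Finset.range n)] with s hs
    have h1 := sub_mem (prod_sub_qp n s hs) (hE n)
    have h2 := OO_anti (m := n) (by omega) h1
    simpa using h2
  have h3 : eulerInf = E := this.tprod_eq
  rw [h3]
  exact hE n

theorem euler_OO : eulerInf - 1 ∈ OO 1 := by
  have := euler_sub 0
  simp only [qp, Finset.range_zero, Finset.prod_empty] at this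
  exact OO_anti (by norm_num) this

theorem inv_sub_OO {x y : LaurentSeries ℚ} {n : ℤ} (hx : x - 1 ∈ OO 1) (hy : y - 1 ∈ OO 1)
    (h : y - x ∈ OO n) : x⁻¹ - y⁻¹ ∈ OO n := by
  have hx0 := OO_unit_ne hx
  have hy0 := OO_unit_ne hy
  have : x⁻¹ - y⁻¹ = (x⁻¹ * y⁻¹) * (y - x) := by field_simp
  rw [this]
  exact OO_mul' (OO_mul (OO_unit_inv hx) (OO_unit_inv hy)) h (by simp)

theorem gauss_OO (N m : ℤ) : gauss tL N m ∈ OO 0 := by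
  unfold gauss
  split_ifs
  · rw [div_eq_mul_inv, mul_inv]
    exact OO_mul' (OO_unit_mem (qp_OO _)) (OO_mul (OO_unit_inv (qp_OO _)) (OO_unit_inv (qp_OO _)))
      (by simp)
  · exact zero_mem _

theorem gaussHalf_OO (N m : ℤ) : gaussHalf tL N m ∈ OO 0 := by
  unfold gaussHalf
  split_ifs
  · exact gauss_OO _ _
  · exact zero_mem _

theorem gauss_sub_qp (N : ℤ) (m : ℕ) : gauss tL N m - (qp tL m)⁻¹ ∈ OO (4 * (N - m)) := by
  unfold gauss
  split_ifs with h
  · rw [Int.toNat_natCast]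
    have h1 : qp tL N.toNat / (qp tL m * qp tL (N - m).toNat) - (qp tL m)⁻¹
        = (qp tL m)⁻¹ * (qp tL (N - m).toNat)⁻¹ * (qp tL N.toNat - qp tL (N - m).toNat) := by
      have := qp_tL_ne m
      have := qp_tL_ne (N - m).toNat
      field_simp
    rw [h1]
    refine OO_mul' (OO_mul (OO_unit_inv (qp_OO _)) (OO_unit_inv (qp_OO _)))
      (qp_diff (N - m).toNat N.toNat (by omega)) (by omega)
  · rw [zero_sub]
    exact neg_mem (OO_anti (by omega) (OO_unit_inv (qp_OO m)))

theorem gauss_sub_euler (N x : ℤ) (d : ℤ) (h1 : d ≤ x) (h2 : d ≤ N - x) :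
    gauss tL N x - eulerInf⁻¹ ∈ OO (4 * d) := by
  by_cases h : 0 ≤ x ∧ x ≤ N
  · obtain ⟨m, rfl⟩ := Int.eq_ofNat_of_zero_le h.1
    have e1 := OO_anti (m := 4 * d) (by omega) (gauss_sub_qp N m)
    have e2 := inv_sub_OO (qp_OO m) euler_OO (euler_sub m)
    have e3 := add_mem e1 (OO_anti (m := 4 * d) (by omega) e2)
    simpa using e3
  · have : gauss tL N x = 0 := by unfold gauss; rw [if_neg h]
    rw [this, zero_sub]
    exact neg_mem (OO_anti (by omega) (OO_unit_inv euler_OO))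


/-! ### The limit of the bosonic side -/

theorem quad_bound (D A G r : ℤ) (hD : 1 ≤ D) (hG : 0 ≤ G) :
    ∃ C : ℤ, ∀ j : ℤ, 4 * r * |j| + |j| - C ≤ 4 * (D * j ^ 2 + A * j + G) := by
  refine ⟨(|A| + |r| + 1) ^ 2, fun j => ?_⟩
  have h1 : -(|A| * |j|) ≤ A * j := by
    rw [← abs_mul]; exact neg_abs_le _
  have h2 : r * |j| ≤ |r| * |j| := mul_le_mul_of_nonneg_right (le_abs_self r) (abs_nonneg j)
  have h3 : |j| ^ 2 ≤ D * j ^ 2 := by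
    rw [sq_abs]; nlinarith [sq_nonneg j]
  nlinarith [sq_nonneg (2 * |j| - (|A| + |r| + 1)), abs_nonneg j, abs_nonneg A, abs_nonneg r]

theorem bos_summable (p : ℤ → ℤ) (C : ℤ) (hp : ∀ j, |j| - C ≤ p j) :
    Summable fun j => tL ^ p j := by
  apply OO_summable
  intro n
  refine (Set.finite_Icc (-(n + C)) (n + C)).subset ?_
  intro j hj
  by_contra hlt
  apply hj
  refine OO_anti ?_ (tL_zpow (p j))
  have h := hp j
  have : (n : ℤ) + C < |j| := by
    by_contra h2
    exact hlt (abs_le.1 (not_lt.1 h2))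
  omega

theorem bos_lim (p : ℤ → ℤ) (r c C : ℤ) (hr : 1 ≤ r) (hp : ∀ j, 4 * r * |j| + |j| - C ≤ p j)
    (k y L : ℤ) (hy : L + c = 2 * y) (h1 : k ≤ y) (h2 : k ≤ L - y) :
    (∑ᶠ j : ℤ, tL ^ p j * gg tL (2 * L) (L + 2 * r * j + c)) - eulerInf⁻¹ * ∑' j, tL ^ p j
      ∈ OO (4 * k - C) := by
  have hs : Summable fun j => tL ^ p j := by
    refine bos_summable p C fun j => le_trans ?_ (hp j)
    have : 0 ≤ 4 * r * |j| := by positivity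
    omega
  have hf := fs_gg (t := tL) L c r hr (fun j => tL ^ p j)
  rw [← tsum_eq_finsum (L := .unconditional _) hf, ← tsum_mul_left, ← (summable_of_hasFiniteSupport hf).tsum_sub (hs.mul_left _)]
  apply OO_tsum
  intro j
  have e : L + 2 * r * j + c = 2 * (y + r * j) := by linear_combination hy
  rw [e, gg_two]
  have e2 : tL ^ p j * gauss tL L (y + r * j) - eulerInf⁻¹ * tL ^ p j
    = tL ^ p j * (gauss tL L (y + r * j) - eulerInf⁻¹) := by ring
  rw [e2]
  have h3 : r * |j| = |r * j| := by rw [abs_mul, abs_of_pos (by omega : 0 < r)]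
  have h4 := abs_le.1 (le_refl |r * j|)
  refine OO_mul' (tL_zpow _) (gauss_sub_euler L (y + r * j) (k - |r * j|) (by omega) (by omega)) ?_
  have := hp j
  have := abs_nonneg j
  have h5 : 4 * r * |j| = 4 * |r * j| := by rw [← h3]; ring
  omega

theorem bos_final (r a b : ℕ) (hr : 3 ≤ r) : ∃ C : ℤ, ∀ k : ℕ,
    bosF tL r a b ((2 * k + a + b : ℕ) : ℤ) - virChar (r - 1) r b a ∈ OO (4 * k - C) := by
  have hD : (1 : ℤ) ≤ ((r : ℤ) - 1) * r := by nlinarith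
  obtain ⟨C1, hC1⟩ := quad_bound (((r : ℤ) - 1) * r) ((r : ℤ) * b - (r - 1) * a) 0 r hD le_rfl
  obtain ⟨C2, hC2⟩ := quad_bound (((r : ℤ) - 1) * r) (b * (r : ℤ) + (r - 1) * a) (b * a) r hD (by positivity)
  have hp1 : ∀ j : ℤ, 4 * (r : ℤ) * |j| + |j| - C1
      ≤ 4 * (j * (((r : ℤ) - 1) * r * j + r * b - (r - 1) * a)) := by
    intro j; refine (hC1 j).trans (le_of_eq ?_); ring
  have hp2 : ∀ j : ℤ, 4 * (r : ℤ) * |j| + |j| - C2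
      ≤ 4 * ((j * ((r : ℤ) - 1) + b) * (j * r + a)) := by
    intro j; refine (hC2 j).trans (le_of_eq ?_); ring
  have hnn : ∀ j : ℤ, 0 ≤ 4 * (r : ℤ) * |j| := fun j => by positivity
  have s1 := bos_summable _ C1 (fun j => le_trans (by have := hnn j; omega) (hp1 j))
  have s2 := bos_summable _ C2 (fun j => le_trans (by have := hnn j; omega) (hp2 j))
  refine ⟨max C1 C2, fun k => ?_⟩
  unfold virChar bosF
  have hc : ((r - 1 : ℕ) : ℤ) = (r : ℤ) - 1 := by omega
  simp only [hc]
  rw [s1.tsum_sub s2]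
  have b1 := bos_lim _ (r : ℤ) (b - a) C1 (by omega) hp1 k (k + b) ((2 * k + a + b : ℕ) : ℤ)
    (by push_cast; ring) (by omega) (by push_cast; omega)
  have b2 := bos_lim _ (r : ℤ) (b + a) C2 (by omega) hp2 k (k + a + b) ((2 * k + a + b : ℕ) : ℤ)
    (by push_cast; ring) (by omega) (by push_cast; omega)
  have := sub_mem (OO_anti (m := 4 * k - max C1 C2) (by omega) b1)
    (OO_anti (m := 4 * k - max C1 C2) (by omega) b2)
  convert this using 1
  ring

/-! ### The limit of the fermionic side -/

/-- exponent -/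
def FX (a : ℕ) : (n : ℕ) → (Fin n → ℕ) → ℤ
  | 0, _ => 0
  | n + 1, m => -2 * (m 0 : ℤ) * ie a (n + 2) + ((m 0 : ℤ) - hd (Fin.tail m)) ^ 2 + FX a n (Fin.tail m)

theorem PS_OO (a b n : ℕ) : ∀ (w : ℕ) (m : Fin n → ℕ), PS tL a b n w m ∈ OO (FX a n m) := by
  induction n with
  | zero =>
    intro w m
    simp only [PS, FX]
    split_ifs
    · exact OO_one
    · exact zero_mem _
  | succ n ih =>
    intro w m
    simp only [PS, FX]
    refine OO_mul' (OO_mul (tL_zpow _) (OO_mul (tL_zpow _) (gaussHalf_OO _ _))) (ih _ _) ?_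
    simp

theorem TG_OO (a b : ℕ) (ha : 1 ≤ a) (hb : 1 ≤ b) (n : ℕ) (m : Fin n → ℕ) :
    TG tL a b n m ∈ OO ((hd m : ℤ) ^ 2 + FX a n m) := by
  cases n with
  | zero => rw [TG_zero]; simpa [hd, FX] using OO_one
  | succ n =>
    rw [TG_succ tL_ne_zero a b ha hb]
    simp only [FX]
    refine OO_mul' (tL_zpow _) (OO_mul (OO_mul (tL_zpow _) (OO_mul (tL_zpow _) (OO_unit_inv (qp_OO _))))
      (PS_OO a b n _ _)) ?_
    rw [hd_succ]
    simp

theorem FX_bound (a n : ℕ) : ∀ (d k : ℤ), 1 ≤ d → 0 ≤ k → ∃ C : ℤ, 0 ≤ C ∧ ∀ m : Fin n → ℕ,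
    k * (∑ i, (m i : ℤ)) - C ≤ (hd m : ℤ) ^ 2 + d * FX a n m := by
  induction n with
  | zero =>
    intro d k _ _
    exact ⟨0, le_rfl, fun m => by simp [hd, FX]⟩
  | succ n ih =>
    intro d k hd1 hk
    obtain ⟨C, hC0, hC⟩ := ih (1 + 2 * d) ((1 + 2 * d) * k) (by omega) (by positivity)
    refine ⟨(2 * d + k) ^ 2 + C, by positivity, fun m => ?_⟩
    have h := hC (Fin.tail m)
    rw [Fin.sum_univ_succ]
    simp only [FX, hd_succ]
    have hS : (∑ i : Fin n, (m i.succ : ℤ)) = ∑ i, (Fin.tail m i : ℤ) := rfl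
    rw [hS]
    have hS0 : 0 ≤ ∑ i, (Fin.tail m i : ℤ) := by positivity
    generalize (∑ i, (Fin.tail m i : ℤ)) = S at *
    generalize FX a n (Fin.tail m) = F at *
    generalize (hd (Fin.tail m) : ℤ) = y at *
    have hx : (0 : ℤ) ≤ (m 0 : ℤ) := by positivity
    generalize (m 0 : ℤ) = x at *
    have he : x * ie a (n + 2) ≤ x := by
      unfold ie; split_ifs <;> omega
    generalize ie a (n + 2) = e at *
    have key : 2 * (1 + 2 * d) * (k * (x + S) - ((2 * d + k) ^ 2 + C))
        ≤ 2 * (1 + 2 * d) * (x ^ 2 + d * (-2 * x * e + (x - y) ^ 2 + F)) := by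
      have h1 : 2 * d * ((1 + 2 * d) * k * S - C) ≤ 2 * d * (y ^ 2 + (1 + 2 * d) * F) :=
        mul_le_mul_of_nonneg_left h (by omega)
      have h2 : (1 + 2 * d) * (2 * k * x - (2 * d + k) ^ 2) ≤ (1 + 2 * d) * (x ^ 2 - 4 * d * x) :=
        mul_le_mul_of_nonneg_left (by nlinarith [sq_nonneg (x - (2 * d + k))]) (by omega)
      have h3 : (1 + 2 * d) * d * (x * e) ≤ (1 + 2 * d) * d * x :=
        mul_le_mul_of_nonneg_left he (by positivity)
      have h4 : 0 ≤ ((1 + 2 * d) * x - 2 * d * y) ^ 2 := sq_nonneg _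
      have h5 : 0 ≤ (1 + 2 * d) * (d - 1) * (k * S) := by
        have : 0 ≤ d - 1 := by omega
        positivity
      have h6 : 0 ≤ (1 + 2 * d) * (2 * d + k) ^ 2 := by positivity
      nlinarith
    exact le_of_mul_le_mul_left key (by omega)

theorem PS_sub_TG (a b : ℕ) (ha : 1 ≤ a) (hb : 1 ≤ b) (n L : ℕ) (hL : L % 2 = qq a b (n + 1) % 2)
    (m : Fin n → ℕ) :
    tL ^ ((hd m : ℤ) ^ 2) * PS tL a b n L m - TG tL a b n m
      ∈ OO ((hd m : ℤ) ^ 2 + FX a n m + (2 * L - 2 - 4 * hd m)) ∨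
    tL ^ ((hd m : ℤ) ^ 2) * PS tL a b n L m - TG tL a b n m = 0 := by
  cases n with
  | zero =>
    right
    have : ((L : ℤ) + ie a 1 + ie b 1) % 2 = 0 := by
      unfold qq at hL
      unfold ie
      split_ifs <;> omega
    rw [TG_zero]
    simp [PS, hd, this]
  | succ n =>
    rw [TG_succ tL_ne_zero a b ha hb]
    simp only [PS, FX, hd_succ]
    by_cases hP : PS tL a b n (m 0) (Fin.tail m) = 0
    · right; rw [hP]; simp
    left
    have hpar : m 0 % 2 = qq a b (n + 1) % 2 ∧ parity (n + 3) a b (Fin.tail m) := by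
      rw [PS_closed tL_ne_zero a b ha hb] at hP
      by_contra hcon
      rw [if_neg hcon] at hP
      exact hP rfl
    have hh := parity_hd n a b (Fin.tail m) hpar.2
    have heven : ((L : ℤ) + ie a (n + 2) + ie b (n + 2) + hd (Fin.tail m)) % 2 = 0 := by
      unfold qq at hL hh
      unfold ie
      split_ifs <;> omega
    have hge : (L : ℤ) ≤ (L : ℤ) + ie a (n + 2) + ie b (n + 2) + hd (Fin.tail m) := by
      have := ie_nonneg a (n + 2)
      have := ie_nonneg b (n + 2)
      omega
    unfold gaussHalf
    rw [if_pos heven]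
    have hg := gauss_sub_qp (((L : ℤ) + ie a (n + 2) + ie b (n + 2) + hd (Fin.tail m)) / 2) (m 0)
    have hg' := OO_anti (m := 2 * L - 2 - 4 * m 0) (by omega) hg
    generalize gauss tL (((L : ℤ) + ie a (n + 2) + ie b (n + 2) + hd (Fin.tail m)) / 2) (m 0) = g at *
    have hPS := PS_OO a b n (m 0) (Fin.tail m)
    have := OO_mul (OO_mul (tL_zpow ((m 0 : ℤ) ^ 2)) (OO_mul (OO_mul (tL_zpow (-2 * (m 0 : ℤ) * ie a (n + 2)))
      (tL_zpow (((m 0 : ℤ) - hd (Fin.tail m)) ^ 2))) hPS)) hg'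
    convert this using 1
    ring

theorem TG_summable (a b : ℕ) (ha : 1 ≤ a) (hb : 1 ≤ b) (n : ℕ) : Summable (TG tL a b n) := by
  obtain ⟨C, -, hC⟩ := FX_bound a n 1 1 le_rfl (by norm_num)
  apply OO_summable
  intro N
  refine (box n (N + C.toNat)).finite_toSet.subset ?_
  intro m hm
  simp only [box, Finset.mem_coe, Fintype.mem_piFinset, Finset.mem_range]
  intro i
  by_contra hlt
  apply hm
  refine OO_anti ?_ (TG_OO a b ha hb n m)
  have h1 := hC m
  have h2 : (m i : ℤ) ≤ ∑ i, (m i : ℤ) :=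
    Finset.single_le_sum (f := fun i => (m i : ℤ)) (fun _ _ => by positivity) (Finset.mem_univ i)
  omega

theorem ferm_final (a b : ℕ) (ha : 1 ≤ a) (hb : 1 ≤ b) (n : ℕ) : ∃ C : ℤ, ∀ L : ℕ,
    L % 2 = qq a b (n + 1) % 2 →
    ∑ m ∈ box n (L + 1), tL ^ ((hd m : ℤ) ^ 2) * PS tL a b n L m - ∑' m, TG tL a b n m
      ∈ OO ((L : ℤ) - C) := by
  obtain ⟨C1, h10, hC1⟩ := FX_bound a n 1 1 le_rfl (by norm_num)
  obtain ⟨C4, h40, hC4⟩ := FX_bound a n 1 4 le_rfl (by norm_num)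
  refine ⟨C1 + C4 + 2, fun L hL => ?_⟩
  have hz : ∀ m ∉ box n (L + 1), (if m ∈ box n (L + 1) then
      tL ^ ((hd m : ℤ) ^ 2) * PS tL a b n L m else 0) = 0 := fun m hm => if_neg hm
  have hs : Summable (fun m => if m ∈ box n (L + 1) then
      tL ^ ((hd m : ℤ) ^ 2) * PS tL a b n L m else 0) := summable_of_ne_finset_zero hz
  have e : ∑ m ∈ box n (L + 1), tL ^ ((hd m : ℤ) ^ 2) * PS tL a b n L m
      = ∑' m, if m ∈ box n (L + 1) then tL ^ ((hd m : ℤ) ^ 2) * PS tL a b n L m else 0 := by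
    rw [tsum_eq_sum hz]
    exact Finset.sum_congr rfl fun m hm => (if_pos hm).symm
  rw [e, ← hs.tsum_sub (TG_summable a b ha hb n)]
  apply OO_tsum
  intro m
  have hle : ∀ i, (m i : ℤ) ≤ ∑ i, (m i : ℤ) := fun i =>
    Finset.single_le_sum (f := fun i => (m i : ℤ)) (fun _ _ => by positivity) (Finset.mem_univ i)
  have hhd : (hd m : ℤ) ≤ ∑ i, (m i : ℤ) := by
    cases n with
    | zero => simp [hd]
    | succ n => exact hle 0
  split_ifs with hm
  · rcases PS_sub_TG a b ha hb n L hL m with h | h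
    · refine OO_anti ?_ h
      have := hC4 m
      omega
    · rw [h]; exact zero_mem _
  · rw [zero_sub]
    refine neg_mem (OO_anti ?_ (TG_OO a b ha hb n m))
    simp only [box, Fintype.mem_piFinset, Finset.mem_range, not_forall] at hm
    obtain ⟨i, hi⟩ := hm
    have := hle i
    have := hC1 m
    omega

theorem TG_main (a b n : ℕ) (ha : 1 ≤ a) (hb : 1 ≤ b) (ha' : a ≤ n + 2) (hb' : b ≤ n + 1) :
    ∑' m, TG tL a b n m
      = tL ^ (((a : ℤ) - b) * (a - b - 1)) * virChar (n + 3 - 1) (n + 3) b a := by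
  obtain ⟨C1, hC1⟩ := bos_final (n + 3) a b (by omega)
  obtain ⟨C2, hC2⟩ := ferm_final a b ha hb n
  rw [← sub_eq_zero]
  apply OO_eq_zero
  intro N
  set e := ((a : ℤ) - b) * (a - b - 1) with he
  set k := N + C1.toNat + C2.toNat + e.natAbs with hk
  have h1 := hC1 k
  have h2 := hC2 (2 * k + a + b) (by unfold qq; omega)
  have hm := melzer tL_ne_zero qp_tL_ne a b (2 * k + a + b + 1) (n + 1) (2 * k + a + b) ha hb
    (by omega) (by omega) (by omega)
  rw [unroll qp_tL_ne a b _ (by omega) n (2 * k + a + b) (fun x => tL ^ ((x : ℤ) ^ 2))] at hm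
  have hcast : ((n + 1 : ℕ) : ℤ) + 2 = ((n + 3 : ℕ) : ℤ) := by push_cast; ring
  rw [hcast, ← he] at hm
  rw [hm] at h2
  have h3 := OO_mul (tL_zpow e) h1
  have h4 := sub_mem (OO_anti (m := N) (by omega) h3) (OO_anti (m := N) (by push_cast; omega) h2)
  convert h4 using 1
  ring

/-- **Fermionic representation of the unitary minimal Virasoro characters**
`χ^{(r-1,r)}_{b,a}(q)` (Stony Brook conjecture, proven via Melzer's identities),
stated in the variable `t = q^{1/4}` (all exponents multiplied by `4`). -/
theorem fermionic_character (r a b : ℕ) (hr : 3 ≤ r) (ha : 1 ≤ a) (ha' : a ≤ r - 1)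
    (hb : 1 ≤ b) (hb' : b ≤ r - 2) :
    virChar (r - 1) r b a
      = tL ^ (-(((a : ℤ) - b) * ((a : ℤ) - b - 1)))
          * ∑' m : Fin (r - 3) → ℕ,
            (if parity r a b m then
              tL ^ (quadC (r - 3) m - 2 * mAt (r - 3) m ((r : ℤ) - a - 1))
                * (qp tL (mAtN (r - 3) m 1))⁻¹
                * ∏ i : Fin (r - 3),
                    (if 1 ≤ (i : ℕ) then gaussHalf tL (topC r a b 0 m i) (m i) else 1)
            else 0) := by
  obtain ⟨n, rfl⟩ : ∃ n, r = n + 3 := ⟨r - 3, by omega⟩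
  have h := TG_main a b n ha hb (by omega) (by omega)
  have h' : virChar (n + 3 - 1) (n + 3) b a
      = tL ^ (-(((a : ℤ) - b) * ((a : ℤ) - b - 1))) * ∑' m, TG tL a b n m := by
    rw [h, ← mul_assoc, ← zpow_add₀ tL_ne_zero, neg_add_cancel, zpow_zero, one_mul]
  exact h'
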